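/- arXiv:1009.2029 — 5 statements merged into one kernel-verified Lean document; each statement's English description precedes it below -/
import Mathlib

section
/- Let (z,z',w,w') be admissible, N ≥ 1, and let 𝒟^{(N)} be the matrix on GT_N built from parameters (u,u',v,v') = (z+N−1, z'+N−1, w, w'). Then the unnormalized N-th level zw-weight M' satisfies detailed balance with respect to 𝒟^{(N)}: for all λ, ν ∈ GT_N, M'_{z,z',w,w'|N}(λ) · 𝒟^{(N)}(λ,ν) = M'_{z,z',w,w'|N}(ν) · 𝒟^{(N)}(ν,λ). -/
/-- A signature of length `N`: a nonincreasing `N`-tuple of integers. -/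
def Sig (N : ℕ) : Type := {f : Fin N → ℤ // ∀ i j : Fin N, i ≤ j → f j ≤ f i}

instance {N : ℕ} : DecidableEq (Sig N) := by unfold Sig; infer_instance

/-- Interlacing `ν ≺ λ` between a signature of length `N` and one of length `N+1`. -/
def Interlace {N : ℕ} (ν : Sig N) (lam : Sig (N + 1)) : Prop :=
  ∀ i : Fin N, lam.1 i.succ ≤ ν.1 i ∧ ν.1 i ≤ lam.1 i.castSucc

instance {N : ℕ} (ν : Sig N) (lam : Sig (N + 1)) : Decidable (Interlace ν lam) := by
  unfold Interlace; infer_instance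

/-- `∏_{i<j} (f i - i - f j + j)` (the Vandermonde-type product in shifted coordinates). -/
def vprod {N : ℕ} (f : Fin N → ℤ) : ℤ :=
  ∏ i : Fin N, ∏ j : Fin N,
    if i < j then (f i - (i : ℕ) - f j + (j : ℕ)) else 1

/-- The link (cotransition probability) `Λ^{N+1}_N(λ, ν)`. -/
noncomputable def link {N : ℕ} (lam : Sig (N + 1)) (ν : Sig N) : ℝ :=
  if Interlace ν lam then (Nat.factorial N : ℝ) * (vprod ν.1 : ℝ) / (vprod lam.1 : ℝ) else 0

/-- Shifted coordinates of a signature: `l_j = λ_j + N − j` (1-based), i.e.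
`lc λ i = λ_i + N − 1 − i` in 0-based indexing. -/
def lc {N : ℕ} (lam : Sig N) : Fin N → ℤ :=
  fun i => lam.1 i + (N : ℤ) - 1 - (i : ℕ)

/-- The Vandermonde product `∏_{i<j} (x_i − x_j)` (as a complex number). -/
def Vc {N : ℕ} (x : Fin N → ℤ) : ℂ :=
  ∏ i : Fin N, ∏ j : Fin N, if i < j then ((x i : ℂ) - (x j : ℂ)) else 1

/-- The one-dimensional bilateral birth-and-death rate matrix `𝒟` on `ℤ` with
parameters `(u,u',v,v')`. -/
def Dmat (u u' v v' : ℂ) (x y : ℤ) : ℂ :=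
  if y = x + 1 then ((x : ℂ) - u) * ((x : ℂ) - u')
  else if y = x - 1 then ((x : ℂ) + v) * ((x : ℂ) + v')
  else if y = x then -(((x : ℂ) - u) * ((x : ℂ) - u')) - ((x : ℂ) + v) * ((x : ℂ) + v')
  else 0

/-- The constant `d_N = N(N−1)(N−2)/3 − (u+u'+v+v')·N(N−1)/2`. -/
noncomputable def dConst (u u' v v' : ℂ) (N : ℕ) : ℂ :=
  (N : ℂ) * ((N : ℂ) - 1) * ((N : ℂ) - 2) / 3 -
    (u + u' + v + v') * ((N : ℂ) * ((N : ℂ) - 1)) / 2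

/-- The matrix `𝒟^{(N)}` of transition rates on `GT_N`:
`𝒟^{(N)}(λ,ν) = (V(n)/V(l)) Σ_i 𝒟(l_i,n_i)·[l_j = n_j ∀ j ≠ i] − d_N·[λ = ν]`. -/
noncomputable def DN (u u' v v' : ℂ) {N : ℕ} (lam ν : Sig N) : ℂ :=
  (Vc (lc ν) / Vc (lc lam)) *
      (∑ i : Fin N,
        if ∀ j : Fin N, j ≠ i → lc lam j = lc ν j then
          Dmat u u' v v' (lc lam i) (lc ν i) else 0) -
    (if lam = ν then dConst u u' v v' N else 0)

/-- Admissibility of the parameters `(z, z', w, w')`: `(z+k)(z'+k) > 0` and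
`(w+k)(w'+k) > 0` (as positive real numbers) for every `k ∈ ℤ`, and
`z + z' + w + w' > −1`. -/
def Admissible (z z' w w' : ℂ) : Prop :=
  (∀ k : ℤ, 0 < ((z + k) * (z' + k)).re ∧ ((z + k) * (z' + k)).im = 0) ∧
  (∀ k : ℤ, 0 < ((w + k) * (w' + k)).re ∧ ((w + k) * (w' + k)).im = 0) ∧
  ((-1 : ℝ) < (z + z' + w + w').re ∧ (z + z' + w + w').im = 0)

/-- The Askey–Lesky weight
`W(x) = 1/(Γ(z+N−x)Γ(z'+N−x)Γ(w+1+x)Γ(w'+1+x))`. -/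
noncomputable def Wfun (z z' w w' : ℂ) (N : ℕ) (x : ℤ) : ℂ :=
  1 / (Complex.Gamma (z + (N : ℂ) - (x : ℂ)) * Complex.Gamma (z' + (N : ℂ) - (x : ℂ)) *
        Complex.Gamma (w + 1 + (x : ℂ)) * Complex.Gamma (w' + 1 + (x : ℂ)))

/-- The unnormalized `N`-th level `zw`-weight
`M'_{z,z',w,w'|N}(λ) = V(l)² ∏_i W(l_i)`. -/
noncomputable def Mzw (z z' w w' : ℂ) {N : ℕ} (lam : Sig N) : ℂ :=
  (Vc (lc lam)) ^ 2 * ∏ i : Fin N, Wfun z z' w w' N (lc lam i)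

/-- `W` is symmetric for the upward step of the birth-and-death matrix. -/
theorem Wfun_mul_step (z z' w w' : ℂ) (N : ℕ) (x : ℤ) :
    Wfun z z' w w' N x *
        (((x : ℂ) - (z + (N : ℂ) - 1)) * ((x : ℂ) - (z' + (N : ℂ) - 1)))
      = Wfun z z' w w' N (x + 1) *
        ((((x + 1 : ℤ) : ℂ) + w) * (((x + 1 : ℤ) : ℂ) + w')) := by
  have key (s t : ℂ) (h : t = s + 1) :
      (Complex.Gamma s)⁻¹ = s * (Complex.Gamma t)⁻¹ :=
    h ▸ Complex.one_div_Gamma_eq_self_mul_one_div_Gamma_add_one s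
  unfold Wfun
  push_cast
  simp only [one_div, mul_inv]
  rw [key (z + N - (x + 1)) (z + N - x) (by ring),
    key (z' + N - (x + 1)) (z' + N - x) (by ring),
    key (w + 1 + x) (w + 1 + (x + 1)) (by ring),
    key (w' + 1 + x) (w' + 1 + (x + 1)) (by ring)]
  ring

/-- Detailed balance of the one-dimensional matrix `𝒟` with respect to `W`. -/
theorem Wfun_mul_Dmat (z z' w w' : ℂ) (N : ℕ) (x y : ℤ) :
    Wfun z z' w w' N x * Dmat (z + (N : ℂ) - 1) (z' + (N : ℂ) - 1) w w' x y
      = Wfun z z' w w' N y * Dmat (z + (N : ℂ) - 1) (z' + (N : ℂ) - 1) w w' y x := by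
  have up (x : ℤ) :
      Wfun z z' w w' N x * Dmat (z + (N : ℂ) - 1) (z' + (N : ℂ) - 1) w w' x (x + 1)
        = Wfun z z' w w' N (x + 1) *
          Dmat (z + (N : ℂ) - 1) (z' + (N : ℂ) - 1) w w' (x + 1) x := by
    have h : ¬ x = x + 1 + 1 := by omega
    have h' : x = x + 1 - 1 := by omega
    rw [Dmat, if_pos rfl, Dmat, if_neg h, if_pos h']
    exact Wfun_mul_step z z' w w' N x
  by_cases h₁ : y = x + 1
  · subst h₁
    exact up x
  by_cases h₂ : x = y + 1
  · subst h₂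
    exact (up y).symm
  by_cases h₃ : y = x
  · rw [h₃]
  have h₄ : ¬ y = x - 1 := by omega
  have h₅ : ¬ x = y - 1 := by omega
  simp [Dmat, h₁, h₂, h₃, h₄, h₅, Ne.symm h₃]

/-- Detailed balance (reversibility) of the matrix `𝒟^{(N)}` with parameters
`(z+N−1, z'+N−1, w, w')` with respect to the unnormalized `N`-th level `zw`-weight:
`M'(λ) 𝒟^{(N)}(λ,ν) = M'(ν) 𝒟^{(N)}(ν,λ)`. -/
theorem stmt14 (z z' w w' : ℂ) (hadm : Admissible z z' w w')
    (N : ℕ) (hN : 1 ≤ N) (lam ν : Sig N) :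
    Mzw z z' w w' lam * DN (z + (N : ℂ) - 1) (z' + (N : ℂ) - 1) w w' lam ν
      = Mzw z z' w w' ν * DN (z + (N : ℂ) - 1) (z' + (N : ℂ) - 1) w w' ν lam := by
  by_cases h : lam = ν
  · rw [h]
  have hV (a b : ℂ) : a ^ 2 * (b / a) = a * b := by
    rcases eq_or_ne a 0 with rfl | ha
    · simp
    · field_simp
  have hsum : (∏ i, Wfun z z' w w' N (lc lam i)) *
      (∑ i : Fin N, if ∀ j : Fin N, j ≠ i → lc lam j = lc ν j then
        Dmat (z + (N : ℂ) - 1) (z' + (N : ℂ) - 1) w w' (lc lam i) (lc ν i) else 0)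
      = (∏ i, Wfun z z' w w' N (lc ν i)) *
      (∑ i : Fin N, if ∀ j : Fin N, j ≠ i → lc ν j = lc lam j then
        Dmat (z + (N : ℂ) - 1) (z' + (N : ℂ) - 1) w w' (lc ν i) (lc lam i) else 0) := by
    rw [Finset.mul_sum, Finset.mul_sum]
    refine Finset.sum_congr rfl fun i _ => ?_
    by_cases hi : ∀ j : Fin N, j ≠ i → lc lam j = lc ν j
    · rw [if_pos hi, if_pos fun j hj => (hi j hj).symm,
        ← Finset.mul_prod_erase _ _ (Finset.mem_univ i),
        ← Finset.mul_prod_erase _ (fun j => Wfun z z' w w' N (lc ν j)) (Finset.mem_univ i),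
        Finset.prod_congr rfl fun j hj => by rw [hi j (Finset.ne_of_mem_erase hj)],
        mul_right_comm, Wfun_mul_Dmat, mul_right_comm]
    · rw [if_neg hi, if_neg fun h' => hi fun j hj => (h' j hj).symm, mul_zero, mul_zero]
  simp only [Mzw, DN, if_neg h, if_neg (Ne.symm h), sub_zero]
  rw [mul_mul_mul_comm, hV, mul_mul_mul_comm (Vc (lc ν) ^ 2), hV, hsum, mul_comm (Vc (lc lam))]
end

section
/- Let (z,z',w,w') be admissible, N ≥ 1, and let 𝒟^{(N)} be the matrix on GT_N built from parameters (u,u',v,v') = (z+N−1, z'+N−1, w, w'). Then for every ν ∈ GT_N: Σ_{λ∈GT_N} M'_{z,z',w,w'|N}(λ) · 𝒟^{(N)}(λ,ν) = 0, where the sum has only finitely many nonzero terms (namely λ = ν and λ = ν ± e_i). That is, the N-th level zw-measure is invariant for 𝒟^{(N)} at the level of transition rates. -/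
theorem Wfun_mul_Dmat_comm (z z' w w' : ℂ) (N : ℕ) (x y : ℤ) :
    Wfun z z' w w' N x * Dmat (z + N - 1) (z' + N - 1) w w' x y =
      Wfun z z' w w' N y * Dmat (z + N - 1) (z' + N - 1) w w' y x := by
  have step (x : ℤ) : Wfun z z' w w' N x * Dmat (z + N - 1) (z' + N - 1) w w' x (x + 1) =
      Wfun z z' w w' N (x + 1) * Dmat (z + N - 1) (z' + N - 1) w w' (x + 1) x := by
    have g (a b : ℂ) (h : b = a + 1) : (Complex.Gamma a)⁻¹ = a * (Complex.Gamma b)⁻¹ := by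
      rw [h, Complex.one_div_Gamma_eq_self_mul_one_div_Gamma_add_one]
    have h₁ := g (z + N - (x + 1 : ℤ)) (z + N - x) (by push_cast; ring)
    have h₂ := g (z' + N - (x + 1 : ℤ)) (z' + N - x) (by push_cast; ring)
    have h₃ := g (w + 1 + x) (w + 1 + (x + 1 : ℤ)) (by push_cast; ring)
    have h₄ := g (w' + 1 + x) (w' + 1 + (x + 1 : ℤ)) (by push_cast; ring)
    have hne : x ≠ x + 1 + 1 := by omega
    simp only [Dmat, Wfun, one_div, mul_inv, h₁, h₂, h₃, h₄, if_true, hne, if_false,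
      add_sub_cancel_right]
    push_cast
    ring
  by_cases h₁ : y = x + 1
  · rw [h₁, step]
  by_cases h₂ : x = y + 1
  · rw [h₂, step]
  by_cases h₃ : y = x
  · rw [h₃]
  · have a₁ : y ≠ x - 1 := by omega
    have a₂ : x ≠ y - 1 := by omega
    simp [Dmat, h₁, h₂, h₃, a₁, a₂, Ne.symm h₃]

theorem support_Dmat_subset (u u' v v' : ℂ) (x : ℤ) :
    (Function.support fun y => Dmat u u' v v' x y) ⊆ ({x + 1, x - 1, x} : Finset ℤ) := by
  intro y hy
  simp only [Finset.coe_insert, Finset.coe_singleton, Set.mem_insert_iff, Set.mem_singleton_iff]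
  by_contra! h
  exact hy (by simp [Dmat, h.1, h.2.1, h.2.2])

theorem finsum_Dmat_mul (u u' v v' : ℂ) (x : ℤ) (f : ℤ → ℂ) :
    ∑ᶠ y, Dmat u u' v v' x y * f y =
      (x - u) * (x - u') * (f (x + 1) - f x) + (x + v) * (x + v') * (f (x - 1) - f x) := by
  rw [finsum_eq_sum_of_support_subset (s := {x + 1, x - 1, x}) _
    ((Function.support_mul_subset_left _ _).trans (support_Dmat_subset u u' v v' x)),
    Finset.sum_insert (by simp; omega), Finset.sum_insert (by simp), Finset.sum_singleton]
  have h₁ : x - 1 ≠ x + 1 := by omega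
  have h₂ : x ≠ x - 1 := by omega
  simp [Dmat, h₁, h₂]
  ring

open Polynomial in
/-- The image of `X ^ k` under the second-order difference operator `𝒟`. -/
noncomputable def diffOpMonomial (u u' v v' : ℂ) (k : ℕ) : ℂ[X] :=
  (X - C u) * (X - C u') * ((X + 1) ^ k - X ^ k) + (X + C v) * (X + C v') * ((X - 1) ^ k - X ^ k)

open Polynomial in
theorem diffOpMonomial_sub_mem_degreeLT (u u' v v' : ℂ) (k : ℕ) :
    diffOpMonomial u u' v v' k - C (k * (k - 1) - (u + u' + v + v') * k) * X ^ k ∈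
      degreeLT ℂ k := by
  have hX {p : ℂ[X]} {m : ℕ} (h : p ∈ degreeLT ℂ m) : X * p ∈ degreeLT ℂ (m + 1) := by
    rw [mem_degreeLT] at h ⊢
    rw [mul_comm, degree_mul_X]
    push_cast
    exact WithBot.add_lt_add_right (by simp) h
  have hmono {p : ℂ[X]} {m : ℕ} (h : p ∈ degreeLT ℂ m) : p ∈ degreeLT ℂ (m + 1) :=
    degreeLT_mono (Nat.le_succ m) h
  have hXk (m : ℕ) : (X ^ m : ℂ[X]) ∈ degreeLT ℂ (m + 1) := by
    rw [mem_degreeLT, degree_X_pow]; exact_mod_cast Nat.lt_succ_self m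
  have hC {p : ℂ[X]} {m : ℕ} (c : ℂ) (h : p ∈ degreeLT ℂ m) : C c * p ∈ degreeLT ℂ m := by
    rw [← smul_eq_C_mul]; exact Submodule.smul_mem _ _ h
  let a (k : ℕ) : ℂ[X] := (X + 1) ^ k + (X - 1) ^ k - 2 * X ^ k
  let b (k : ℕ) : ℂ[X] := (X + 1) ^ k - (X - 1) ^ k
  have ha (k : ℕ) : a (k + 1) = X * a k + b k := by simp only [a, b]; ring
  have hb (k : ℕ) : b (k + 1) = X * b k + a k + C 2 * X ^ k := by
    simp only [a, b, map_ofNat]; ring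
  have key (k : ℕ) : a k ∈ degreeLT ℂ k ∧ b k ∈ degreeLT ℂ k ∧ X * a k ∈ degreeLT ℂ k ∧
      X * b k - C (2 * k : ℂ) * X ^ k ∈ degreeLT ℂ k ∧
      X * (X * a k) - C (k * (k - 1) : ℂ) * X ^ k ∈ degreeLT ℂ k := by
    induction k with
    | zero =>
      have h₁ : a 0 = 0 := by simp only [a]; ring
      have h₂ : b 0 = 0 := by simp only [b]; ring
      simp [h₁, h₂]
    | succ k ih =>
      obtain ⟨i₁, i₂, i₃, i₄, i₅⟩ := ih
      refine ⟨?_, ?_, ?_, ?_, ?_⟩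
      · rw [ha]; exact add_mem (hmono i₃) (hmono i₂)
      · rw [hb]; exact add_mem (add_mem (hX i₂) (hmono i₁)) (hC _ (hXk k))
      · rw [ha, mul_add]; exact add_mem (hX i₃) (hX i₂)
      · convert add_mem (hX i₄) (hmono i₃) using 1
        rw [hb]; simp only [map_mul, map_ofNat, Nat.cast_succ, map_add, map_one]; ring
      · convert add_mem (hX i₅) (hX i₄) using 1
        rw [ha]
        simp only [map_mul, map_ofNat, Nat.cast_succ, map_add, map_sub, map_one]
        ring
  obtain ⟨i₁, i₂, i₃, i₄, i₅⟩ := key k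
  have e : diffOpMonomial u u' v v' k - C (k * (k - 1) - (u + u' + v + v') * k) * X ^ k =
      (X * (X * a k) - C (k * (k - 1) : ℂ) * X ^ k) + C ((v + v' - u - u') / 2) * (X * a k) +
      C ((u * u' + v * v') / 2) * a k +
      C (-(u + u' + v + v') / 2) * (X * b k - C (2 * k : ℂ) * X ^ k) +
      C ((u * u' - v * v') / 2) * b k := by
    have h2 : (2 : ℂ[X]) * C (2⁻¹) = 1 := by
      rw [← map_ofNat C 2, ← C_mul]; norm_num
    simp only [diffOpMonomial, a, b, div_eq_mul_inv, map_mul, map_ofNat, map_add,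
      map_sub, map_neg, map_one]
    generalize (C (2⁻¹) : ℂ[X]) = h at h2
    obtain ⟨p, hp⟩ : ∃ p : ℂ[X], (X + 1) ^ k = p := ⟨_, rfl⟩
    obtain ⟨q, hq⟩ : ∃ q : ℂ[X], (X - 1) ^ k = q := ⟨_, rfl⟩
    obtain ⟨r, hr⟩ : ∃ r : ℂ[X], X ^ k = r := ⟨_, rfl⟩
    rw [hp, hq, hr]
    grind
  rw [e]
  exact add_mem (add_mem (add_mem (add_mem i₅ (hC _ i₃)) (hC _ i₁)) (hC _ i₄)) (hC _ i₂)

/-- Applying a linear map `A` to one row at a time acts on the determinant as its trace. -/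
theorem sum_det_updateRow_mul {R n : Type*} [CommRing R] [Fintype n] [DecidableEq n]
    (M A : Matrix n n R) :
    ∑ i, (M.updateRow i ((M * A) i)).det = A.trace * M.det := by
  have h (i : n) : (M.updateRow i ((M * A) i)).det = (M * A * M.adjugate) i i := by
    rw [← Matrix.cramer_transpose_apply, Matrix.cramer_eq_adjugate_mulVec,
      ← Matrix.adjugate_transpose, Matrix.mulVec_transpose]
    rfl
  simp_rw [h]
  change (M * A * M.adjugate).trace = _
  rw [Matrix.trace_mul_cycle, Matrix.adjugate_mul]
  simp [mul_comm]

theorem Vc_eq_mul_det_vandermonde {N : ℕ} (x : Fin N → ℤ) :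
    Vc x = (∏ i : Fin N, ∏ _j ∈ Finset.Ioi i, (-1 : ℂ)) *
      (Matrix.vandermonde fun i => (x i : ℂ)).det := by
  rw [Matrix.det_vandermonde, ← Finset.prod_mul_distrib]
  refine Finset.prod_congr rfl fun i _ => ?_
  rw [← Finset.prod_mul_distrib, ← Finset.prod_filter]
  refine Finset.prod_congr (by ext; simp) fun j _ => by ring

theorem vandermonde_update {R : Type*} [CommRing R] {N : ℕ} (x : Fin N → R) (i : Fin N) (y : R) :
    Matrix.vandermonde (Function.update x i y) =
      (Matrix.vandermonde x).updateRow i fun k => y ^ (k : ℕ) := by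
  ext j k
  by_cases h : j = i
  · subst h; simp [Matrix.vandermonde_apply]
  · simp [Matrix.vandermonde_apply, h]

theorem coeff_diffOpMonomial_self (u u' v v' : ℂ) (k : ℕ) :
    (diffOpMonomial u u' v v' k).coeff k = k * (k - 1) - (u + u' + v + v') * k := by
  have h := Polynomial.coeff_eq_zero_of_degree_lt
    (Polynomial.mem_degreeLT.1 (diffOpMonomial_sub_mem_degreeLT u u' v v' k))
  rw [Polynomial.coeff_sub, Polynomial.coeff_C_mul, Polynomial.coeff_X_pow_self] at h
  linear_combination h

theorem natDegree_diffOpMonomial_le (u u' v v' : ℂ) (k : ℕ) :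
    (diffOpMonomial u u' v v' k).natDegree ≤ k := by
  have h := Polynomial.mem_degreeLT.1 (diffOpMonomial_sub_mem_degreeLT u u' v v' k)
  rw [Polynomial.natDegree_le_iff_degree_le]
  refine (Polynomial.degree_le_iff_coeff_zero _ _).2 fun m hm => ?_
  have hm' : k < m := by exact_mod_cast hm
  have h' := Polynomial.coeff_eq_zero_of_degree_lt (h.trans hm)
  rwa [Polynomial.coeff_sub, Polynomial.coeff_C_mul, Polynomial.coeff_X_pow, if_neg hm'.ne',
    mul_zero, sub_zero] at h'

theorem dConst_eq_sum (u u' v v' : ℂ) (N : ℕ) :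
    dConst u u' v v' N =
      ∑ k : Fin N, (((k : ℕ) : ℂ) * ((k : ℕ) - 1) - (u + u' + v + v') * (k : ℕ)) := by
  rw [Fin.sum_univ_eq_sum_range (fun k : ℕ => (k : ℂ) * (k - 1) - (u + u' + v + v') * k) N]
  induction N with
  | zero => simp [dConst]
  | succ N ih => rw [Finset.sum_range_succ, ← ih]; simp only [dConst]; push_cast; ring

/-- The Vandermonde product is an eigenfunction of `∑ᵢ 𝒟ᵢ` with eigenvalue `d_N`. -/
theorem sum_finsum_Dmat_mul_Vc_update (u u' v v' : ℂ) {N : ℕ} (n : Fin N → ℤ) :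
    ∑ i, ∑ᶠ y, Dmat u u' v v' (n i) y * Vc (Function.update n i y) =
      dConst u u' v v' N * Vc n := by
  let M : Matrix (Fin N) (Fin N) ℂ := Matrix.vandermonde fun i => (n i : ℂ)
  let A : Matrix (Fin N) (Fin N) ℂ := .of fun j k => (diffOpMonomial u u' v v' k).coeff j
  have hMA (i k : Fin N) : (M * A) i k =
      (n i - u) * (n i - u') * ((n i + 1 : ℂ) ^ (k : ℕ) - (n i : ℂ) ^ (k : ℕ)) +
        (n i + v) * (n i + v') * ((n i - 1 : ℂ) ^ (k : ℕ) - (n i : ℂ) ^ (k : ℕ)) := by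
    have hdeg := (natDegree_diffOpMonomial_le u u' v v' k).trans_lt k.2
    trans (diffOpMonomial u u' v v' k).eval (n i : ℂ)
    · rw [Polynomial.eval_eq_sum_range' hdeg, Matrix.mul_apply, Finset.sum_range]
      simp [M, A, Matrix.vandermonde_apply, mul_comm]
    · simp [diffOpMonomial]
  have hrow (i : Fin N) : ∑ᶠ y, Dmat u u' v v' (n i) y * Vc (Function.update n i y) =
      (∏ i : Fin N, ∏ _j ∈ Finset.Ioi i, (-1 : ℂ)) * (M.updateRow i ((M * A) i)).det := by
    have hV (y : ℤ) : Vc (Function.update n i y) =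
        (∏ i : Fin N, ∏ _j ∈ Finset.Ioi i, (-1 : ℂ)) *
          Matrix.cramer M.transpose (fun k => (y : ℂ) ^ (k : ℕ)) i := by
      rw [Vc_eq_mul_det_vandermonde, Matrix.cramer_transpose_apply, ← vandermonde_update]
      congr 3
      ext j
      by_cases h : j = i
      · subst h; simp
      · simp [h]
    have hMA' : (M * A) i =
        ((n i - u) * (n i - u')) • ((fun k : Fin N => ((n i + 1 : ℤ) : ℂ) ^ (k : ℕ)) -
          fun k : Fin N => (n i : ℂ) ^ (k : ℕ)) +
        ((n i + v) * (n i + v')) • ((fun k : Fin N => ((n i - 1 : ℤ) : ℂ) ^ (k : ℕ)) -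
          fun k : Fin N => (n i : ℂ) ^ (k : ℕ)) := by
      ext k
      simp [hMA]
    rw [finsum_Dmat_mul, hV, hV, hV, ← Matrix.cramer_transpose_apply, hMA', map_add, map_smul,
      map_smul, map_sub, map_sub]
    simp only [Pi.add_apply, Pi.smul_apply, Pi.sub_apply, smul_eq_mul]
    ring
  have htrace : A.trace = dConst u u' v v' N := by
    simp [dConst_eq_sum, Matrix.trace, A, coeff_diffOpMonomial_self]
  simp_rw [hrow]
  rw [← Finset.mul_sum, sum_det_updateRow_mul, htrace, Vc_eq_mul_det_vandermonde]
  ring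

theorem lc_injective {N : ℕ} : Function.Injective (lc (N := N)) := by
  intro a b h
  refine Subtype.ext (funext fun i => ?_)
  have := congrFun h i
  simp only [lc] at this
  omega

theorem lc_strictAnti {N : ℕ} (lam : Sig N) : StrictAnti (lc lam) := by
  intro i j h
  have h₁ := lam.2 i j h.le
  have h₂ : (i : ℕ) < j := h
  simp only [lc]
  omega

theorem exists_lc_eq {N : ℕ} {l : Fin N → ℤ} (hl : StrictAnti l) : ∃ lam : Sig N, lc lam = l := by
  refine ⟨⟨fun i => l i - N + 1 + (i : ℕ), fun i j hij => ?_⟩, by ext i; simp only [lc]; ring⟩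
  have key (d : ℕ) : ∀ i j : Fin N, (j : ℕ) = i + d → l j + d ≤ l i := by
    induction d with
    | zero => intro i j h; simp [show j = i from Fin.ext h]
    | succ d ih =>
      intro i j h
      have h₁ := ih i ⟨i + d, by omega⟩ rfl
      have h₂ : l j < l ⟨i + d, by omega⟩ := hl (Fin.lt_def.2 (by simp; omega))
      push_cast
      omega
  have h₁ : (i : ℕ) ≤ j := hij
  have h₂ := key (j - i : ℕ) i j (by omega)
  push_cast [h₁] at h₂
  linarith

theorem Vc_eq_zero_of_eq {N : ℕ} {x : Fin N → ℤ} {i j : Fin N} (hij : i < j) (h : x i = x j) :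
    Vc x = 0 :=
  Finset.prod_eq_zero (Finset.mem_univ i) <|
    Finset.prod_eq_zero (Finset.mem_univ j) (by simp [hij, h])

theorem Vc_lc_ne_zero {N : ℕ} (lam : Sig N) : Vc (lc lam) ≠ 0 := by
  refine Finset.prod_ne_zero_iff.2 fun i _ => Finset.prod_ne_zero_iff.2 fun j _ => ?_
  split_ifs with h
  · exact sub_ne_zero.2 (by exact_mod_cast (lc_strictAnti lam h).ne')
  · exact one_ne_zero

/-- A unit step from a strictly decreasing tuple is strictly decreasing unless `Vc` vanishes. -/
theorem strictAnti_of_Dmat_mul_Vc_ne_zero {u u' v v' : ℂ} {N : ℕ} {n l : Fin N → ℤ}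
    (hn : StrictAnti n) {i : Fin N} (hl : ∀ j, j ≠ i → l j = n j)
    (h : Dmat u u' v v' (n i) (l i) * Vc l ≠ 0) : StrictAnti l := by
  have hi := support_Dmat_subset u u' v v' (n i) (left_ne_zero_of_mul h)
  simp only [Finset.coe_insert, Finset.coe_singleton, Set.mem_insert_iff,
    Set.mem_singleton_iff] at hi
  intro a b hab
  have hlt := hn hab
  have hne : l a ≠ l b := fun e => right_ne_zero_of_mul h (Vc_eq_zero_of_eq hab e)
  by_cases ha : a = i
  · have hb := hl b (ha ▸ hab.ne')
    subst ha
    omega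
  · have ha' := hl a ha
    by_cases hb : b = i
    · subst hb; omega
    · have hb' := hl b hb; omega

theorem finsum_lc_sum_Dmat_mul_Vc (u u' v v' : ℂ) {N : ℕ} {n : Fin N → ℤ} (hn : StrictAnti n) :
    (fun lam : Sig N => ∑ i, if ∀ j, j ≠ i → lc lam j = n j then
      Dmat u u' v v' (n i) (lc lam i) * Vc (lc lam) else 0).HasFiniteSupport ∧
    ∑ᶠ lam : Sig N, (∑ i, if ∀ j, j ≠ i → lc lam j = n j then
      Dmat u u' v v' (n i) (lc lam i) * Vc (lc lam) else 0) = dConst u u' v v' N * Vc n := by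
  let h (l : Fin N → ℤ) (i : Fin N) : ℂ :=
    if ∀ j, j ≠ i → l j = n j then Dmat u u' v v' (n i) (l i) * Vc l else 0
  have hupd {l : Fin N → ℤ} {i : Fin N} (hl : ∀ j, j ≠ i → l j = n j) :
      Function.update n i (l i) = l := by
    ext j
    by_cases hj : j = i
    · subst hj; simp
    · simp [hj, hl j hj]
  have hrange (i : Fin N) :
      (Function.support fun l => h l i) ⊆ Set.range (Function.update n i) := fun l hl =>
    ⟨l i, hupd (by by_contra hc; exact hl (if_neg hc))⟩
  have hfin (i : Fin N) : (Function.support fun l => h l i).Finite := by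
    refine ((Finset.finite_toSet {n i + 1, n i - 1, n i}).image (Function.update n i)).subset ?_
    intro l hl
    have hc : ∀ j, j ≠ i → l j = n j := by by_contra hc; exact hl (if_neg hc)
    have hl' : Dmat u u' v v' (n i) (l i) * Vc l ≠ 0 := by
      have : h l i ≠ 0 := hl
      simpa only [h, if_pos hc] using this
    exact ⟨l i, support_Dmat_subset u u' v v' (n i) (left_ne_zero_of_mul hl'), hupd hc⟩
  have hsupp : (Function.support fun l => ∑ i, h l i) ⊆ ⋃ i, Function.support fun l => h l i := by
    intro l hl
    obtain ⟨i, -, hi⟩ := Finset.exists_ne_zero_of_sum_ne_zero hl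
    exact Set.mem_iUnion.2 ⟨i, hi⟩
  have hlc : (Function.support fun l => ∑ i, h l i) ⊆ Set.range (lc (N := N)) := by
    intro l hl
    obtain ⟨i, hi⟩ := Set.mem_iUnion.1 (hsupp hl)
    have hc : ∀ j, j ≠ i → l j = n j := by by_contra hc; exact hi (if_neg hc)
    have hl' : Dmat u u' v v' (n i) (l i) * Vc l ≠ 0 := by
      have : h l i ≠ 0 := hi
      simpa only [h, if_pos hc] using this
    exact exists_lc_eq (strictAnti_of_Dmat_mul_Vc_ne_zero hn hc hl')
  have huniv {α β : Type} {f : β → ℂ} {g : α → β} (hg : Function.Injective g)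
      (hs : Function.support f ⊆ Set.range g) : ∑ᶠ a, f (g a) = ∑ᶠ b, f b := by
    rw [← finsum_mem_range hg, ← finsum_mem_univ f, finsum_mem_inter_support_eq]
    rw [Set.inter_eq_right.2 hs, Set.univ_inter]
  refine ⟨((Set.finite_iUnion hfin).subset hsupp).preimage lc_injective.injOn, ?_⟩
  change ∑ᶠ lam : Sig N, (fun l => ∑ i, h l i) (lc lam) = _
  rw [huniv lc_injective hlc, finsum_sum_comm _ _ fun i _ => hfin i,
    ← sum_finsum_Dmat_mul_Vc_update]
  refine Finset.sum_congr rfl fun i _ => ?_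
  rw [← huniv (Function.update_injective n i) (hrange i)]
  refine finsum_congr fun y => ?_
  simp +contextual [h]

theorem Mzw_mul_DN (z z' w w' : ℂ) {N : ℕ} (lam ν : Sig N) :
    Mzw z z' w w' lam * DN (z + (N : ℂ) - 1) (z' + (N : ℂ) - 1) w w' lam ν =
      Vc (lc ν) * (∏ i, Wfun z z' w w' N (lc ν i)) *
        (∑ i, if ∀ j, j ≠ i → lc lam j = lc ν j then
          Dmat (z + (N : ℂ) - 1) (z' + (N : ℂ) - 1) w w' (lc ν i) (lc lam i) * Vc (lc lam)
        else 0) -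
      if lam = ν then dConst (z + (N : ℂ) - 1) (z' + (N : ℂ) - 1) w w' N * Mzw z z' w w' ν
      else 0 := by
  rw [DN, mul_sub]
  congr 1
  · have hV := Vc_lc_ne_zero lam
    rw [Mzw, ← mul_assoc, Finset.mul_sum, Finset.mul_sum]
    refine Finset.sum_congr rfl fun i _ => ?_
    split_ifs with hc
    · have hW : (∏ k, Wfun z z' w w' N (lc lam k)) *
          Dmat (z + (N : ℂ) - 1) (z' + (N : ℂ) - 1) w w' (lc lam i) (lc ν i) =
          (∏ k, Wfun z z' w w' N (lc ν k)) *
          Dmat (z + (N : ℂ) - 1) (z' + (N : ℂ) - 1) w w' (lc ν i) (lc lam i) := by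
        rw [Fintype.prod_eq_mul_prod_compl i, Fintype.prod_eq_mul_prod_compl i,
          Finset.prod_congr rfl fun k hk => by
            rw [hc k (by simpa using hk)],
          mul_right_comm, Wfun_mul_Dmat_comm]
        ring
      field_simp
      linear_combination Vc (lc ν) * hW
    · simp
  · split_ifs with h
    · rw [h]; ring
    · simp

/-- Invariance of the `N`-th level `zw`-measure at the level of transition rates
(Theorem 5.2 of Borodin–Olshanski, invariance step): for every `ν ∈ GT_N`,
`Σ_λ M'_{z,z',w,w'|N}(λ) 𝒟^{(N)}(λ,ν) = 0`, where `𝒟^{(N)}` is built from the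
parameters `(z+N−1, z'+N−1, w, w')`. -/
theorem stmt15 (z z' w w' : ℂ) (hadm : Admissible z z' w w')
    (N : ℕ) (hN : 1 ≤ N) (ν : Sig N) :
    ∑ᶠ lam : Sig N, Mzw z z' w w' lam * DN (z + (N : ℂ) - 1) (z' + (N : ℂ) - 1) w w' lam ν
      = 0 := by
  obtain ⟨hfin, hsum⟩ := finsum_lc_sum_Dmat_mul_Vc (z + (N : ℂ) - 1) (z' + (N : ℂ) - 1) w w'
    (lc_strictAnti ν)
  simp_rw [Mzw_mul_DN]
  rw [finsum_sub_distrib, ← mul_finsum, hsum, finsum_eq_single _ ν fun x hx => if_neg hx,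
    if_pos rfl, Mzw]
  · ring
  · exact hfin.subset (Function.support_mul_subset_right _ _)
  · exact (Set.finite_singleton ν).subset fun x hx => by_contra fun h => hx (if_neg h)
end

section
/- In the multivariate setting below, for every N ≥ 2, every x_N ∈ A_N and every Y = (y_1,…,y_{N−1}) ∈ A^{(N−1)}: Σ_{X ∈ A^{(N−1)}} Λ(x_N, X) · Q^{(N−1)}(X, Y) = Σ_{z ∈ A_N} Q_N(x_N, z) · Λ(z, Y), where Λ(x_N, (x_1,…,x_{N−1})) = Λ^N_{N−1}(x_N,x_{N−1}) · Λ^{N−1}_{N−2}(x_{N−1},x_{N−2}) ⋯ Λ^2_1(x_2,x_1), and both sums have finitely many nonzero terms. In matrix notation, Λ Q^{(N−1)} = Q_N Λ. -/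
open scoped Classical

section Multivariate

variable {A : ℕ → Type}

/-- `Δ^{k+1}_k(x, y) = Σ_{v ≠ x} Q_{k+1}(x, v) Λ^{k+1}_k(v, y)`. -/
noncomputable def DeltaM (Q : ∀ k, A k → A k → ℝ) (L : ∀ k, A (k + 1) → A k → ℝ)
    (k : ℕ) (x : A (k + 1)) (y : A k) : ℝ :=
  ∑ᶠ v : A (k + 1), if v ≠ x then Q (k + 1) x v * L k v y else 0

/-- `Q̂_{k+1}(x, v, y) = Q_{k+1}(x,v) Λ^{k+1}_k(v,y) / Δ^{k+1}_k(x,y)` if the denominator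
is nonzero, and `0` otherwise. -/
noncomputable def QhatM (Q : ∀ k, A k → A k → ℝ) (L : ∀ k, A (k + 1) → A k → ℝ)
    (k : ℕ) (x v : A (k + 1)) (y : A k) : ℝ :=
  if DeltaM Q L k x y ≠ 0 then Q (k + 1) x v * L k v y / DeltaM Q L k x y else 0

/-- The link factor `Λ^k_{k−1}(y, x_{k−1})` below level `k`, with the convention
`Λ^1_0 ≡ 1` at the bottom level. -/
def linkFac (L : ∀ k, A (k + 1) → A k → ℝ) {M : ℕ} (X : ∀ k : Fin M, A (k : ℕ)) :
    (k : ℕ) → k < M → A k → ℝ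
  | 0, _, _ => 1
  | j + 1, h, y => L j y (X ⟨j, Nat.lt_of_succ_lt h⟩)

/-- Off-diagonal entries of the multivariate transition rate matrix `Q^{(M)}`
(as a function of arbitrary tuples; only the restriction to `A^{(M)}` is used):
a jump of the coordinates on the interval `[k, l]` (where `k`, `l` are the smallest and
largest indices where `X` and `Y` differ, with the differing set equal to the full
interval `[k,l]` and the blocking links vanishing) has rate
`Q_k(x_k,y_k)·(Λ(y_k,x_{k−1})/Λ(x_k,x_{k−1}))·∏_{j=k+1}^{l} Q̂_j(x_j,y_j,y_{j−1})`. -/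
noncomputable def offDiagM (Q : ∀ k, A k → A k → ℝ) (L : ∀ k, A (k + 1) → A k → ℝ)
    {M : ℕ} (X Y : ∀ k : Fin M, A (k : ℕ)) : ℝ :=
  if h : X = Y then 0
  else
    have hS : (Finset.univ.filter fun k : Fin M => X k ≠ Y k).Nonempty := by
      obtain ⟨k, hk⟩ := Function.ne_iff.mp h
      exact ⟨k, Finset.mem_filter.mpr ⟨Finset.mem_univ k, hk⟩⟩
    let k := (Finset.univ.filter fun k : Fin M => X k ≠ Y k).min' hS
    let l := (Finset.univ.filter fun k : Fin M => X k ≠ Y k).max' hS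
    if ((Finset.univ.filter fun k : Fin M => X k ≠ Y k) = Finset.Icc k l) ∧
        (∀ (j : ℕ) (hj : j + 1 < M), (k : ℕ) ≤ j → j < (l : ℕ) →
          L j (X ⟨j + 1, hj⟩) (Y ⟨j, Nat.lt_of_succ_lt hj⟩) = 0) then
      Q (k : ℕ) (X k) (Y k) * linkFac L X (k : ℕ) k.isLt (Y k) /
          linkFac L X (k : ℕ) k.isLt (X k) *
        ∏ j ∈ Finset.Ico (k : ℕ) (l : ℕ),
          (if hj : j + 1 < M then
            QhatM Q L j (X ⟨j + 1, hj⟩) (Y ⟨j + 1, hj⟩) (Y ⟨j, Nat.lt_of_succ_lt hj⟩)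
          else 1)
    else 0

/-- The state space `A^{(M)}` of Gelfand–Tsetlin-type tuples: `(x_0,…,x_{M−1})` with all
consecutive link weights nonzero. -/
def PathSp (L : ∀ k, A (k + 1) → A k → ℝ) (M : ℕ) : Type :=
  {X : ∀ k : Fin M, A (k : ℕ) //
    ∀ (k : ℕ) (h : k + 1 < M), L k (X ⟨k + 1, h⟩) (X ⟨k, Nat.lt_of_succ_lt h⟩) ≠ 0}

/-- The multivariate transition rate matrix `Q^{(M)}` on `A^{(M)}`; the diagonal entry is
minus the sum of the off-diagonal ones in the row. -/
noncomputable def QM (Q : ∀ k, A k → A k → ℝ) (L : ∀ k, A (k + 1) → A k → ℝ)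
    (M : ℕ) (X Y : PathSp L M) : ℝ :=
  if X = Y then -∑ᶠ Z : PathSp L M, offDiagM Q L X.1 Z.1 else offDiagM Q L X.1 Y.1

/-- The product of link weights along a tuple:  `∏_k Λ^{k+1}_k(x_{k+1}, x_k)`. -/
noncomputable def chainL (L : ∀ k, A (k + 1) → A k → ℝ) {M : ℕ}
    (X : ∀ k : Fin M, A (k : ℕ)) : ℝ :=
  ∏ j ∈ Finset.range M,
    (if h : j + 1 < M then L j (X ⟨j + 1, h⟩) (X ⟨j, Nat.lt_of_succ_lt h⟩) else 1)

/-- The link weight from a point of `A_n` to the top coordinate of a tuple of length `n`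
(equal to `1` when `n = 0`). -/
def topLink (L : ∀ k, A (k + 1) → A k → ℝ) :
    (n : ℕ) → A n → (∀ k : Fin n, A (k : ℕ)) → ℝ
  | 0, _, _ => 1
  | m + 1, x, X => L m x (X ⟨m, Nat.lt_succ_self m⟩)

/-- `Λ(x, (x_0,…,x_{n−1})) = Λ^{n}_{n−1}(x, x_{n−1}) Λ^{n−1}_{n−2}(x_{n−1},x_{n−2}) ⋯`:
the link from `A_n` to `A^{(n)}`. -/
noncomputable def bigLink (L : ∀ k, A (k + 1) → A k → ℝ) (n : ℕ) (x : A n)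
    (X : PathSp L n) : ℝ :=
  topLink L n x X.1 * chainL L X.1

/-- The links along a jump of the coordinates in `[k, l]` vanish. -/
def JumpBlocked (L : ∀ k, A (k + 1) → A k → ℝ) {M : ℕ} (X Y : ∀ k : Fin M, A (k : ℕ))
    (k l : Fin M) : Prop :=
  ∀ (j : ℕ) (hj : j + 1 < M), (k : ℕ) ≤ j → j < (l : ℕ) →
    L j (X ⟨j + 1, hj⟩) (Y ⟨j, Nat.lt_of_succ_lt hj⟩) = 0

/-- The rate of a jump of the coordinates in `[k, l]`. -/
noncomputable def jumpRate (Q : ∀ k, A k → A k → ℝ) (L : ∀ k, A (k + 1) → A k → ℝ)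
    {M : ℕ} (X Y : ∀ k : Fin M, A (k : ℕ)) (k l : Fin M) : ℝ :=
  Q (k : ℕ) (X k) (Y k) * linkFac L X (k : ℕ) k.isLt (Y k) / linkFac L X (k : ℕ) k.isLt (X k) *
    ∏ j ∈ Finset.Ico (k : ℕ) (l : ℕ),
      (if hj : j + 1 < M then
        QhatM Q L j (X ⟨j + 1, hj⟩) (Y ⟨j + 1, hj⟩) (Y ⟨j, Nat.lt_of_succ_lt hj⟩)
      else 1)

lemma offDiagM_self (Q : ∀ k, A k → A k → ℝ) (L : ∀ k, A (k + 1) → A k → ℝ) {M : ℕ}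
    (X : ∀ k : Fin M, A (k : ℕ)) : offDiagM Q L X X = 0 := by
  simp [offDiagM]

lemma offDiagM_of_forall_iff (Q : ∀ k, A k → A k → ℝ) (L : ∀ k, A (k + 1) → A k → ℝ) {M : ℕ}
    {X Y : ∀ k : Fin M, A (k : ℕ)} {k l : Fin M} (hkl : k ≤ l)
    (h : ∀ j, X j ≠ Y j ↔ k ≤ j ∧ j ≤ l) :
    offDiagM Q L X Y = if JumpBlocked L X Y k l then jumpRate Q L X Y k l else 0 := by
  have hXY : X ≠ Y := fun e => (h k).2 ⟨le_rfl, hkl⟩ (congrFun e k)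
  have hS : (Finset.univ.filter fun k : Fin M => X k ≠ Y k).Nonempty :=
    ⟨k, by simpa using (h k).2 ⟨le_rfl, hkl⟩⟩
  have hk : k = (Finset.univ.filter fun k : Fin M => X k ≠ Y k).min' hS := by
    refine le_antisymm ?_ ?_
    · exact Finset.le_min' _ _ _ fun j hj => ((h j).1 (Finset.mem_filter.1 hj).2).1
    · exact Finset.min'_le _ _ (by simpa using (h k).2 ⟨le_rfl, hkl⟩)
  have hl : l = (Finset.univ.filter fun k : Fin M => X k ≠ Y k).max' hS := by
    refine le_antisymm ?_ ?_
    · exact Finset.le_max' _ _ (by simpa using (h l).2 ⟨hkl, le_rfl⟩)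
    · exact Finset.max'_le _ _ _ fun j hj => ((h j).1 (Finset.mem_filter.1 hj).2).2
  have hIcc : (Finset.univ.filter fun k : Fin M => X k ≠ Y k) = Finset.Icc k l := by
    ext j
    simpa using h j
  subst hk hl
  unfold offDiagM
  rw [dif_neg hXY]
  exact if_congr (and_iff_right hIcc) rfl rfl

lemma exists_of_offDiagM_ne_zero {Q : ∀ k, A k → A k → ℝ} {L : ∀ k, A (k + 1) → A k → ℝ} {M : ℕ}
    {X Y : ∀ k : Fin M, A (k : ℕ)} (h : offDiagM Q L X Y ≠ 0) :
    ∃ k l : Fin M, k ≤ l ∧ ∀ j, X j ≠ Y j ↔ k ≤ j ∧ j ≤ l := by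
  unfold offDiagM at h
  split_ifs at h with hXY
  · exact absurd rfl h
  · have hc := (ite_ne_right_iff.1 h).1.1
    have key := fun j => Finset.ext_iff.1 hc j
    simp only [Finset.mem_filter, Finset.mem_univ, true_and, Finset.mem_Icc] at key
    exact ⟨_, _, Finset.min'_le_max' _ _, key⟩

lemma linkFac_init (L : ∀ k, A (k + 1) → A k → ℝ) {n : ℕ} (X : ∀ k : Fin (n + 1), A (k : ℕ))
    (k : ℕ) (h : k < n) (y : A k) :
    linkFac L X k (h.trans n.lt_succ_self) y
      = linkFac L (M := n) (Fin.init X) k h y := by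
  cases k <;> rfl

lemma linkFac_last (L : ∀ k, A (k + 1) → A k → ℝ) {n : ℕ} (X : ∀ k : Fin (n + 1), A (k : ℕ))
    (y : A n) : linkFac L X n n.lt_succ_self y = topLink L n y (Fin.init X) := by
  cases n <;> rfl

lemma topLink_succ (L : ∀ k, A (k + 1) → A k → ℝ) {n : ℕ} (x : A (n + 1))
    (X : ∀ k : Fin (n + 1), A (k : ℕ)) : topLink L (n + 1) x X = L n x (X (Fin.last n)) := rfl

lemma chainL_succ (L : ∀ k, A (k + 1) → A k → ℝ) {n : ℕ} (X : ∀ k : Fin (n + 1), A (k : ℕ)) :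
    chainL L X = topLink L n (X (Fin.last n)) (Fin.init X) * chainL L (M := n) (Fin.init X) := by
  unfold chainL
  rw [Finset.prod_range_succ, dif_neg (lt_irrefl _), mul_one]
  cases n with
  | zero => simp [topLink]
  | succ m =>
    rw [Finset.prod_range_succ, Finset.prod_range_succ _ m, dif_pos (Nat.lt_succ_self _),
      dif_neg (lt_irrefl _), mul_one, mul_comm]
    congr 1
    refine Finset.prod_congr rfl fun j hj => ?_
    have := Finset.mem_range.1 hj
    rw [dif_pos (by omega), dif_pos (by omega)]
    rfl

/-- The total weight `Σ_z Q_n(u, z) Λ(z, Y)` for a tuple `Y` of length `n`. -/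
noncomputable def rateLink (Q : ∀ k, A k → A k → ℝ) (L : ∀ k, A (k + 1) → A k → ℝ)
    (n : ℕ) (u : A n) (Y : ∀ k : Fin n, A (k : ℕ)) : ℝ :=
  ∑ᶠ z : A n, Q n u z * topLink L n z Y

/-- The conditional law of the new top coordinate, started at `u`, when the coordinates below jump
to `Y`. -/
noncomputable def topJump (Q : ∀ k, A k → A k → ℝ) (L : ∀ k, A (k + 1) → A k → ℝ)
    (n : ℕ) (u v : A n) (Y : ∀ k : Fin n, A (k : ℕ)) : ℝ :=
  if topLink L n u Y ≠ 0 then (if v = u then 1 else 0)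
  else Q n u v * topLink L n v Y / rateLink Q L n u Y

lemma QhatM_eq_topJump (Q : ∀ k, A k → A k → ℝ) (L : ∀ k, A (k + 1) → A k → ℝ) {m : ℕ}
    (u v : A (m + 1)) (Y : ∀ k : Fin (m + 1), A (k : ℕ)) (h : topLink L (m + 1) u Y = 0) :
    QhatM Q L m u v (Y (Fin.last m)) = topJump Q L (m + 1) u v Y := by
  have hD : DeltaM Q L m u (Y (Fin.last m)) = rateLink Q L (m + 1) u Y := by
    refine finsum_congr fun z => ?_
    rw [topLink_succ] at h ⊢
    split_ifs with hz
    · rfl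
    · rw [not_not.1 hz, h, mul_zero]
  rw [topJump, if_neg (not_not.2 h), QhatM, hD, topLink_succ]
  split_ifs with h0
  · rfl
  · rw [not_not.1 h0, div_zero]

/-- Recursive form of `offDiagM`, splitting off the top coordinates `u`, `v`. -/
noncomputable def offStep (Q : ∀ k, A k → A k → ℝ) (L : ∀ k, A (k + 1) → A k → ℝ) (n : ℕ)
    (X : ∀ k : Fin n, A (k : ℕ)) (u : A n) (Y : ∀ k : Fin n, A (k : ℕ)) (v : A n) : ℝ :=
  if X = Y then (if v = u then 0 else Q n u v * topLink L n v X / topLink L n u X)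
  else offDiagM Q L X Y * topJump Q L n u v Y

lemma jumpBlocked_init (L : ∀ k, A (k + 1) → A k → ℝ) {n : ℕ}
    (X Y : ∀ k : Fin (n + 1), A (k : ℕ)) (k l : Fin n) :
    JumpBlocked L X Y k.castSucc l.castSucc
      ↔ JumpBlocked L (M := n) (Fin.init X) (Fin.init Y) k l :=
  ⟨fun h j hj h1 h2 => h j (by omega) h1 h2,
    fun h j _ h1 h2 => h j (by have := l.2; simp at h2; omega) h1 h2⟩

lemma jumpRate_init (Q : ∀ k, A k → A k → ℝ) (L : ∀ k, A (k + 1) → A k → ℝ) {n : ℕ}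
    (X Y : ∀ k : Fin (n + 1), A (k : ℕ)) (k l : Fin n) :
    jumpRate Q L X Y k.castSucc l.castSucc
      = jumpRate Q L (M := n) (Fin.init X) (Fin.init Y) k l := by
  unfold jumpRate
  congr 1
  · have h1 := linkFac_init L X k k.2 (Y k.castSucc)
    have h2 := linkFac_init L X k k.2 (X k.castSucc)
    exact congrArg₂ (fun a b => Q k (X k.castSucc) (Y k.castSucc) * a / b) h1 h2
  · refine Finset.prod_congr rfl fun j hj => ?_
    have h1 := (Finset.mem_Ico.1 hj).2
    have h2 := l.2
    replace h1 : j < (l : ℕ) := h1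
    rw [dif_pos (by omega), dif_pos (by omega)]
    rfl

lemma offDiagM_of_last_eq (Q : ∀ k, A k → A k → ℝ) (L : ∀ k, A (k + 1) → A k → ℝ) {n : ℕ}
    {X Y : ∀ k : Fin (n + 1), A (k : ℕ)} (h : X (Fin.last n) = Y (Fin.last n)) :
    offDiagM Q L X Y = offDiagM Q L (M := n) (Fin.init X) (Fin.init Y) := by
  by_cases hE : ∃ k l : Fin n, k ≤ l ∧
      ∀ j : Fin n, X j.castSucc ≠ Y j.castSucc ↔ k ≤ j ∧ j ≤ l
  · obtain ⟨k, l, hkl, hj⟩ := hE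
    rw [offDiagM_of_forall_iff Q L (M := n) (X := Fin.init X) (Y := Fin.init Y) hkl hj,
      offDiagM_of_forall_iff Q L (k := k.castSucc) (l := l.castSucc) (by simpa using hkl) ?_]
    · simp only [jumpBlocked_init, jumpRate_init]
    · intro j
      induction j using Fin.lastCases with
      | last => simp [h, Fin.le_def]
      | cast j => simpa using hj j
  · rw [not_imp_comm.1 (exists_of_offDiagM_ne_zero (Q := Q) (L := L) (M := n)
      (X := Fin.init X) (Y := Fin.init Y)) hE]
    by_contra hne
    obtain ⟨k, l, hkl, hj⟩ := exists_of_offDiagM_ne_zero hne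
    induction l using Fin.lastCases with
    | last => exact (hj (Fin.last n)).2 ⟨hkl, le_rfl⟩ h
    | cast l =>
      induction k using Fin.lastCases with
      | last => exact absurd hkl (by simp [Fin.le_def])
      | cast k => exact hE ⟨k, l, by simpa using hkl, fun j => by simpa using hj j.castSucc⟩

lemma offDiagM_of_init_eq (Q : ∀ k, A k → A k → ℝ) (L : ∀ k, A (k + 1) → A k → ℝ) {n : ℕ}
    {X Y : ∀ k : Fin (n + 1), A (k : ℕ)}
    (h : (Fin.init X : ∀ k : Fin n, A k.castSucc) = Fin.init Y)
    (hl : X (Fin.last n) ≠ Y (Fin.last n)) :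
    offDiagM Q L X Y = Q n (X (Fin.last n)) (Y (Fin.last n)) *
      topLink L n (Y (Fin.last n)) (Fin.init X) / topLink L n (X (Fin.last n)) (Fin.init X) := by
  rw [offDiagM_of_forall_iff Q L (le_refl (Fin.last n)), if_pos, jumpRate]
  · rw [Finset.Ico_self, Finset.prod_empty, mul_one, ← linkFac_last, ← linkFac_last]
    rfl
  · intro j _ h1 h2
    exact absurd h1 (not_le.2 h2)
  · intro j
    induction j using Fin.lastCases with
    | last => simp [hl]
    | cast j =>
      have e : X j.castSucc = Y j.castSucc := congrFun h j
      simp [e, Fin.le_def]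

lemma offDiagM_of_ne_of_ne (Q : ∀ k, A k → A k → ℝ) (L : ∀ k, A (k + 1) → A k → ℝ) {n : ℕ}
    {X Y : ∀ k : Fin (n + 1), A (k : ℕ)}
    (hX : topLink L n (X (Fin.last n)) (Fin.init X) ≠ 0)
    (h : (Fin.init X : ∀ k : Fin n, A k.castSucc) ≠ Fin.init Y)
    (hl : X (Fin.last n) ≠ Y (Fin.last n)) :
    offDiagM Q L X Y = offDiagM Q L (M := n) (Fin.init X) (Fin.init Y) *
      topJump Q L n (X (Fin.last n)) (Y (Fin.last n)) (Fin.init Y) := by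
  cases n with
  | zero => exact absurd (funext fun k => k.elim0) h
  | succ m =>
  by_cases hT : topLink L (m + 1) (X (Fin.last _)) (Fin.init Y) = 0
  · have hm : X (Fin.last m).castSucc ≠ Y (Fin.last m).castSucc := by
      intro e
      refine hX ?_
      rw [topLink_succ] at hT ⊢
      exact (congrArg (L m (X (Fin.last _))) e).trans hT
    by_cases hE : ∃ k l : Fin (m + 1), k ≤ l ∧
        ∀ j : Fin (m + 1), X j.castSucc ≠ Y j.castSucc ↔ k ≤ j ∧ j ≤ l
    · obtain ⟨k, l, hkl, hj⟩ := hE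
      obtain rfl : l = Fin.last m :=
        le_antisymm (Fin.le_last _) ((hj (Fin.last m)).1 hm).2
      rw [offDiagM_of_forall_iff Q L (M := m + 1) (X := Fin.init X) (Y := Fin.init Y) hkl hj,
        offDiagM_of_forall_iff Q L (k := k.castSucc) (l := Fin.last _) (Fin.le_last _) ?_]
      · have hB : JumpBlocked L X Y k.castSucc (Fin.last (m + 1)) ↔
            JumpBlocked L (M := m + 1) (Fin.init X) (Fin.init Y) k (Fin.last m) := by
          refine ⟨fun H j hj h1 h2 => H j (by omega) h1 (by simp at h2 ⊢; omega),
            fun H j hj' h1 h2 => ?_⟩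
          rcases Nat.lt_succ_iff_lt_or_eq.1 (show j < m + 1 from h2) with h3 | rfl
          · exact H j (by omega) h1 h3
          · exact hT
        rw [if_congr hB rfl rfl, ite_mul, zero_mul, ← QhatM_eq_topJump Q L _ _ _ hT]
        congr 1
        rw [← jumpRate_init]
        unfold jumpRate
        have hkm : (k : ℕ) ≤ m := Nat.le_of_lt_succ k.2
        simp only [Fin.val_castSucc, Fin.val_last]
        rw [Finset.prod_Ico_succ_top hkm, ← mul_assoc, dif_pos (Nat.lt_succ_self _)]
        rfl
      · intro j
        induction j using Fin.lastCases with
        | last => simp [hl, Fin.le_last]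
        | cast j =>
          rw [hj j]
          simp [Fin.le_last]
    · rw [not_imp_comm.1 (exists_of_offDiagM_ne_zero (Q := Q) (L := L) (M := m + 1)
        (X := Fin.init X) (Y := Fin.init Y)) hE, zero_mul]
      by_contra hne
      obtain ⟨k, l, hkl, hj⟩ := exists_of_offDiagM_ne_zero hne
      obtain rfl : l = Fin.last (m + 1) :=
        le_antisymm (Fin.le_last _) ((hj (Fin.last _)).1 hl).2
      have hkm := ((hj _).1 hm).1
      induction k using Fin.lastCases with
      | last => exact absurd hkm (by simp [Fin.le_def])
      | cast k =>
        refine hE ⟨k, Fin.last m, Fin.le_last _, fun j => ?_⟩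
        rw [hj j.castSucc]
        simp [Fin.le_last]
  · rw [topJump, if_pos hT, if_neg hl.symm, mul_zero]
    by_contra hne
    obtain ⟨k, l, hkl, hj⟩ := exists_of_offDiagM_ne_zero hne
    obtain rfl : l = Fin.last (m + 1) :=
      le_antisymm (Fin.le_last _) ((hj (Fin.last _)).1 hl).2
    rw [offDiagM_of_forall_iff Q L hkl hj] at hne
    obtain ⟨hB, -⟩ := ite_ne_right_iff.1 hne
    obtain ⟨j, hjne⟩ := Function.ne_iff.1 h
    have hk := ((hj j.castSucc).1 hjne).1
    refine hT (hB m (Nat.lt_succ_self _) ?_ (Nat.lt_succ_self _))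
    have := j.2
    simp only [Fin.le_def, Fin.val_castSucc] at hk
    omega

lemma offDiagM_eq_offStep (Q : ∀ k, A k → A k → ℝ) (L : ∀ k, A (k + 1) → A k → ℝ) {n : ℕ}
    {X Y : ∀ k : Fin (n + 1), A (k : ℕ)}
    (hX : topLink L n (X (Fin.last n)) (Fin.init X) ≠ 0)
    (hY : topLink L n (Y (Fin.last n)) (Fin.init Y) ≠ 0) :
    offDiagM Q L X Y = offStep Q L n (Fin.init X) (X (Fin.last n)) (Fin.init Y)
      (Y (Fin.last n)) := by
  unfold offStep
  split_ifs with h hl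
  · rw [offDiagM_of_last_eq Q L hl.symm, h]
    exact offDiagM_self Q L (M := n) _
  · exact offDiagM_of_init_eq Q L h (Ne.symm hl)
  · by_cases hl : X (Fin.last n) = Y (Fin.last n)
    · rw [offDiagM_of_last_eq Q L hl, topJump, hl, if_pos hY, if_pos rfl, mul_one]
    · exact offDiagM_of_ne_of_ne Q L hX h hl

/-- Splitting a tuple into its top coordinate and the remaining tuple. -/
def PathSp.split {L : ∀ k, A (k + 1) → A k → ℝ} {n : ℕ} (X : PathSp L (n + 1)) :
    A n × PathSp L n :=
  (X.1 (Fin.last n), ⟨Fin.init X.1, fun k h => X.2 k (h.trans n.lt_succ_self)⟩)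

lemma PathSp.topLink_split_ne_zero {L : ∀ k, A (k + 1) → A k → ℝ} {n : ℕ}
    (X : PathSp L (n + 1)) : topLink L n X.split.1 X.split.2.1 ≠ 0 := by
  cases n with
  | zero => exact one_ne_zero
  | succ m => exact X.2 m (Nat.lt_succ_self _)

lemma PathSp.split_injective {L : ∀ k, A (k + 1) → A k → ℝ} {n : ℕ} :
    Function.Injective (PathSp.split : PathSp L (n + 1) → A n × PathSp L n) := by
  intro X Y h
  have h1 : X.1 (Fin.last n) = Y.1 (Fin.last n) := congrArg Prod.fst h
  have h2 : (Fin.init X.1 : ∀ k : Fin n, A k.castSucc) = Fin.init Y.1 :=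
    congrArg Subtype.val (congrArg Prod.snd h)
  refine Subtype.ext (funext fun k => ?_)
  induction k using Fin.lastCases with
  | last => exact h1
  | cast k => exact congrFun h2 k

lemma PathSp.exists_split_eq {L : ∀ k, A (k + 1) → A k → ℝ} {n : ℕ} (p : A n × PathSp L n)
    (hp : topLink L n p.1 p.2.1 ≠ 0) : ∃ X : PathSp L (n + 1), X.split = p := by
  obtain ⟨u, X, hX⟩ := p
  let Z : ∀ k : Fin (n + 1), A k := Fin.snoc (α := fun k : Fin (n + 1) => A k) X u
  have hlast : Z (Fin.last n) = u := Fin.snoc_last (α := fun k : Fin (n + 1) => A k) u X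
  have hcast : ∀ k : Fin n, Z k.castSucc = X k :=
    fun k => Fin.snoc_castSucc (α := fun k : Fin (n + 1) => A k) u X k
  refine ⟨⟨Z, fun k h => ?_⟩, ?_⟩
  · rcases Nat.lt_succ_iff_lt_or_eq.1 h with h1 | rfl
    · have := hX k h1
      rwa [← hcast, ← hcast] at this
    · change L k u (X ⟨k, _⟩) ≠ 0 at hp
      rwa [← hcast, ← hlast] at hp
  · exact Prod.ext hlast (Subtype.ext (funext hcast))

lemma finsum_comp_split {L : ∀ k, A (k + 1) → A k → ℝ} {n : ℕ} (f : A n × PathSp L n → ℝ)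
    (hf : ∀ p, topLink L n p.1 p.2.1 = 0 → f p = 0) :
    ∑ᶠ X : PathSp L (n + 1), f X.split = ∑ᶠ p, f p := by
  rw [← finsum_mem_range PathSp.split_injective, finsum_mem_def]
  refine finsum_congr fun p => ?_
  by_cases hp : topLink L n p.1 p.2.1 = 0
  · rw [hf p hp, Set.indicator_apply, hf p hp, ite_self]
  · exact Set.indicator_of_mem (s := Set.range PathSp.split) (PathSp.exists_split_eq p hp) f

lemma offDiagM_split (Q : ∀ k, A k → A k → ℝ) {L : ∀ k, A (k + 1) → A k → ℝ} {n : ℕ}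
    (X Y : PathSp L (n + 1)) :
    offDiagM Q L X.1 Y.1 = offStep Q L n X.split.2.1 X.split.1 Y.split.2.1 Y.split.1 :=
  offDiagM_eq_offStep Q L X.topLink_split_ne_zero Y.topLink_split_ne_zero

lemma bigLink_split {L : ∀ k, A (k + 1) → A k → ℝ} {n : ℕ} (x : A (n + 1))
    (X : PathSp L (n + 1)) :
    bigLink L (n + 1) x X = L n x X.split.1 * bigLink L n X.split.1 X.split.2 := by
  rw [bigLink, chainL_succ]
  rfl

lemma bigLink_finite {L : ∀ k, A (k + 1) → A k → ℝ}
    (hLfin : ∀ k (x : A (k + 1)), {y : A k | L k x y ≠ 0}.Finite) (n : ℕ) (x : A n) :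
    {X : PathSp L n | bigLink L n x X ≠ 0}.Finite := by
  induction n with
  | zero =>
    have : Subsingleton (PathSp L 0) := ⟨fun X Y => Subtype.ext (funext fun k => k.elim0)⟩
    exact Set.toFinite _
  | succ n ih =>
    have hfin := (hLfin n x).biUnion fun u _ => (Set.finite_singleton u).prod (ih u)
    refine (hfin.preimage PathSp.split_injective.injOn).subset fun X hX => ?_
    rw [Set.mem_ofPred_eq, bigLink_split] at hX
    simp only [Set.mem_preimage, Set.mem_iUnion]
    exact ⟨_, left_ne_zero_of_mul hX, rfl, right_ne_zero_of_mul hX⟩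

lemma offStep_finite {Q : ∀ k, A k → A k → ℝ} {L : ∀ k, A (k + 1) → A k → ℝ}
    (hQfin : ∀ k (x : A k), {y : A k | Q k x y ≠ 0}.Finite) {n : ℕ} {X : PathSp L n}
    (hX : {Y : PathSp L n | offDiagM Q L X.1 Y.1 ≠ 0}.Finite) (u : A n) :
    {p : A n × PathSp L n | offStep Q L n X.1 u p.2.1 p.1 ≠ 0}.Finite := by
  refine (((hQfin n u).insert u).prod (hX.insert X)).subset fun p hp => ?_
  rw [Set.mem_ofPred_eq, offStep] at hp
  split_ifs at hp with h1 h2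
  · exact absurd rfl hp
  · exact ⟨Or.inr (left_ne_zero_of_mul (left_ne_zero_of_mul hp)), Or.inl (Subtype.ext h1.symm)⟩
  · refine ⟨?_, Or.inr (left_ne_zero_of_mul hp)⟩
    replace hp := right_ne_zero_of_mul hp
    rw [topJump] at hp
    split_ifs at hp with h3 h4
    · exact Or.inl h4
    · exact absurd rfl hp
    · exact Or.inr (left_ne_zero_of_mul (left_ne_zero_of_mul hp))

lemma offDiagM_finite {Q : ∀ k, A k → A k → ℝ} (L : ∀ k, A (k + 1) → A k → ℝ)
    (hQfin : ∀ k (x : A k), {y : A k | Q k x y ≠ 0}.Finite) (n : ℕ) (X : PathSp L n) :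
    {Y : PathSp L n | offDiagM Q L X.1 Y.1 ≠ 0}.Finite := by
  induction n with
  | zero =>
    have : Subsingleton (PathSp L 0) := ⟨fun X Y => Subtype.ext (funext fun k => k.elim0)⟩
    exact Set.toFinite _
  | succ n ih =>
    refine ((offStep_finite hQfin (ih X.split.2) X.split.1).preimage
      PathSp.split_injective.injOn).subset fun Y hY => ?_
    rwa [Set.mem_ofPred_eq, offDiagM_split] at hY

lemma rate_last_ne_zero {Q : ∀ k, A k → A k → ℝ} {L : ∀ k, A (k + 1) → A k → ℝ} {m : ℕ}
    {X Y : PathSp L (m + 1)} (h : offDiagM Q L X.1 Y.1 ≠ 0)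
    (hl : X.1 (Fin.last m) ≠ Y.1 (Fin.last m)) :
    Q m (X.1 (Fin.last m)) (Y.1 (Fin.last m)) ≠ 0 := by
  have hl' : Y.split.1 ≠ X.split.1 := hl.symm
  rw [offDiagM_split, offStep, if_neg hl'] at h
  split_ifs at h with h1
  · exact left_ne_zero_of_mul (left_ne_zero_of_mul h)
  · replace h := right_ne_zero_of_mul h
    rw [topJump, if_neg hl'] at h
    split_ifs at h with h2
    · exact absurd rfl h
    · exact left_ne_zero_of_mul (left_ne_zero_of_mul h)

lemma topLink_nonneg {L : ∀ k, A (k + 1) → A k → ℝ} (hL : ∀ k x y, 0 ≤ L k x y) {n : ℕ}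
    (x : A n) (X : ∀ k : Fin n, A (k : ℕ)) : 0 ≤ topLink L n x X := by
  cases n with
  | zero => exact zero_le_one
  | succ m => exact hL _ _ _

lemma rateLink_ne_zero {Q : ∀ k, A k → A k → ℝ} {L : ∀ k, A (k + 1) → A k → ℝ}
    (hQpos : ∀ k (x y : A k), x ≠ y → 0 ≤ Q k x y) (hL : ∀ k x y, 0 ≤ L k x y)
    (hLfin : ∀ k (x : A (k + 1)), {y : A k | L k x y ≠ 0}.Finite)
    (hcomm : ∀ k (x : A (k + 1)) (y : A k),
      ∑ᶠ u : A k, L k x u * Q k u y = ∑ᶠ v : A (k + 1), Q (k + 1) x v * L k v y)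
    {n : ℕ} {u : A n} {X Y : PathSp L n} (hX : topLink L n u X.1 ≠ 0)
    (hY : topLink L n u Y.1 = 0) (h : offDiagM Q L X.1 Y.1 ≠ 0) :
    rateLink Q L n u Y.1 ≠ 0 := by
  cases n with
  | zero => exact absurd hY one_ne_zero
  | succ m =>
    rw [topLink_succ] at hX hY
    have hl : X.1 (Fin.last m) ≠ Y.1 (Fin.last m) := fun e => hX (e ▸ hY)
    refine ne_of_gt ?_
    refine lt_of_lt_of_eq (finsum_pos (fun w => ?_) ⟨X.1 (Fin.last m), ?_⟩ ?_)
      (hcomm m u (Y.1 (Fin.last m)))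
    · by_cases hw : w = Y.1 (Fin.last m)
      · rw [hw, hY, zero_mul]
      · exact mul_nonneg (hL _ _ _) (hQpos _ _ _ hw)
    · exact mul_pos (lt_of_le_of_ne (hL _ _ _) hX.symm)
        (lt_of_le_of_ne (hQpos _ _ _ hl) (rate_last_ne_zero h hl).symm)
    · exact (hLfin m u).subset fun w hw => left_ne_zero_of_mul hw

lemma finsum_topJump {Q : ∀ k, A k → A k → ℝ} {L : ∀ k, A (k + 1) → A k → ℝ} {n : ℕ} {u : A n}
    {Y : ∀ k : Fin n, A (k : ℕ)} (h : topLink L n u Y = 0 → rateLink Q L n u Y ≠ 0) :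
    ∑ᶠ v, topJump Q L n u v Y = 1 := by
  by_cases hY : topLink L n u Y = 0
  · simp only [topJump, hY, ne_eq, not_true_eq_false, if_false, div_eq_mul_inv]
    rw [← finsum_mul]
    exact mul_inv_cancel₀ (h hY)
  · simp only [topJump, ne_eq, hY, not_false_eq_true, if_true]
    rw [finsum_eq_single _ u fun v hv => if_neg hv, if_pos rfl]

lemma topJump_mul_rateLink {Q : ∀ k, A k → A k → ℝ} {L : ∀ k, A (k + 1) → A k → ℝ}
    (hQpos : ∀ k (x y : A k), x ≠ y → 0 ≤ Q k x y) (hL : ∀ k x y, 0 ≤ L k x y)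
    (hQfin : ∀ k (x : A k), {y : A k | Q k x y ≠ 0}.Finite)
    {n : ℕ} {u v : A n} {Y : ∀ k : Fin n, A (k : ℕ)} (hY : topLink L n u Y = 0) :
    topJump Q L n u v Y * rateLink Q L n u Y = Q n u v * topLink L n v Y := by
  rw [topJump, if_neg (not_not.2 hY)]
  refine div_mul_cancel_of_imp fun h0 => ?_
  have hnn : ∀ z, 0 ≤ Q n u z * topLink L n z Y := by
    intro z
    by_cases hz : u = z
    · rw [← hz, hY, mul_zero]
    · exact mul_nonneg (hQpos _ _ _ hz) (topLink_nonneg hL _ _)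
  by_contra hne
  exact (finsum_pos hnn ⟨v, lt_of_le_of_ne (hnn v) (Ne.symm hne)⟩
    ((hQfin n u).subset fun z hz => left_ne_zero_of_mul hz)).ne' h0

lemma offStep_eq_zero (Q : ∀ k, A k → A k → ℝ) {L : ∀ k, A (k + 1) → A k → ℝ} {n : ℕ}
    (X : ∀ k : Fin n, A (k : ℕ)) (u : A n) {Y : ∀ k : Fin n, A (k : ℕ)} {v : A n}
    (h : topLink L n v Y = 0) : offStep Q L n X u Y v = 0 := by
  unfold offStep topJump
  split_ifs with h1 h2 h3 h4
  · rfl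
  · rw [h1, h, mul_zero, zero_div]
  · exact absurd (h4 ▸ h) h3
  · exact mul_zero _
  · rw [h, mul_zero, zero_div, mul_zero]

lemma finsum_offDiagM_split {Q : ∀ k, A k → A k → ℝ} {L : ∀ k, A (k + 1) → A k → ℝ}
    (hQpos : ∀ k (x y : A k), x ≠ y → 0 ≤ Q k x y) (hL : ∀ k x y, 0 ≤ L k x y)
    (hQfin : ∀ k (x : A k), {y : A k | Q k x y ≠ 0}.Finite)
    (hLfin : ∀ k (x : A (k + 1)), {y : A k | L k x y ≠ 0}.Finite)
    (hcomm : ∀ k (x : A (k + 1)) (y : A k),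
      ∑ᶠ u : A k, L k x u * Q k u y = ∑ᶠ v : A (k + 1), Q (k + 1) x v * L k v y)
    {n : ℕ} (X : PathSp L (n + 1)) :
    ∑ᶠ Z : PathSp L (n + 1), offDiagM Q L X.1 Z.1
      = (rateLink Q L n X.split.1 X.split.2.1 / topLink L n X.split.1 X.split.2.1
          - Q n X.split.1 X.split.1)
        + ∑ᶠ Z : PathSp L n, offDiagM Q L X.split.2.1 Z.1 := by
  have hT := X.topLink_split_ne_zero
  generalize hu : X.split.1 = u at *
  generalize hX' : X.split.2 = X' at *
  have hfin := offDiagM_finite L hQfin n X'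
  have hfin' := offStep_finite hQfin hfin u
  calc ∑ᶠ Z : PathSp L (n + 1), offDiagM Q L X.1 Z.1
      = ∑ᶠ p : A n × PathSp L n, offStep Q L n X'.1 u p.2.1 p.1 := by
        rw [← finsum_comp_split _ fun p hp => offStep_eq_zero Q _ _ hp]
        refine finsum_congr fun Z => ?_
        rw [offDiagM_split, hu, hX']
    _ = ∑ᶠ p : PathSp L n × A n, offStep Q L n X'.1 u p.1.1 p.2 :=
        (finsum_comp_equiv (Equiv.prodComm (PathSp L n) (A n))).symm
    _ = ∑ᶠ (Z : PathSp L n) (v : A n), offStep Q L n X'.1 u Z.1 v :=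
        finsum_curry _ (hfin'.preimage (Equiv.prodComm (PathSp L n) (A n)).injective.injOn)
    _ = ∑ᶠ Z : PathSp L n, ((if Z = X' then rateLink Q L n u X'.1 / topLink L n u X'.1 - Q n u u
          else 0) + offDiagM Q L X'.1 Z.1) := by
        refine finsum_congr fun Z => ?_
        split_ifs with hZ
        · subst hZ
          rw [offDiagM_self, add_zero, rateLink, div_eq_mul_inv, finsum_mul]
          have hs : Q n u u = ∑ᶠ v : A n, if v = u then Q n u u else 0 := by
            rw [finsum_eq_single _ u fun v hv => if_neg hv, if_pos rfl]
          rw [hs, ← finsum_sub_distrib]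
          · refine finsum_congr fun v => ?_
            rw [offStep, if_pos rfl]
            split_ifs with hv
            · rw [hv, mul_assoc, mul_inv_cancel₀ hT, mul_one, sub_self]
            · rw [sub_zero, div_eq_mul_inv]
          · exact (hQfin n u).subset fun v hv =>
              left_ne_zero_of_mul (left_ne_zero_of_mul hv)
          · exact (Set.finite_singleton u).subset fun v hv => (ite_ne_right_iff.1 hv).1
        · have hZ' : X'.1 ≠ Z.1 := fun e => hZ (Subtype.ext e.symm)
          simp only [offStep, if_neg hZ', zero_add]
          rw [← mul_finsum]
          by_cases h0 : offDiagM Q L X'.1 Z.1 = 0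
          · rw [h0, zero_mul]
          · rw [finsum_topJump fun hY => rateLink_ne_zero hQpos hL hLfin hcomm hT hY h0, mul_one]
    _ = _ := by
        rw [finsum_add_distrib _ hfin, finsum_eq_single _ X' fun Z hZ => if_neg hZ, if_pos rfl]
        exact (Set.finite_singleton X').subset fun v hv => (ite_ne_right_iff.1 hv).1

/-- The multivariate commutation `Λ Q^{(n)} = Q_n Λ`. -/
theorem finsum_bigLink_mul_QM {Q : ∀ k, A k → A k → ℝ} {L : ∀ k, A (k + 1) → A k → ℝ}
    (hQpos : ∀ k (x y : A k), x ≠ y → 0 ≤ Q k x y) (hL : ∀ k x y, 0 ≤ L k x y)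
    (hQfin : ∀ k (x : A k), {y : A k | Q k x y ≠ 0}.Finite)
    (hQsum : ∀ k (x : A k), ∑ᶠ y : A k, Q k x y = 0)
    (hLfin : ∀ k (x : A (k + 1)), {y : A k | L k x y ≠ 0}.Finite)
    (hcomm : ∀ k (x : A (k + 1)) (y : A k),
      ∑ᶠ u : A k, L k x u * Q k u y = ∑ᶠ v : A (k + 1), Q (k + 1) x v * L k v y)
    (n : ℕ) (x : A n) (Y : PathSp L n) :
    ∑ᶠ X : PathSp L n, bigLink L n x X * QM Q L n X Y
      = ∑ᶠ z : A n, Q n x z * bigLink L n z Y := by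
  induction n with
  | zero =>
    have : Subsingleton (PathSp L 0) := ⟨fun X Y => Subtype.ext (funext fun k => k.elim0)⟩
    have hoff : ∀ X Z : PathSp L 0, offDiagM Q L X.1 Z.1 = 0 := fun X Z => by
      rw [Subsingleton.elim X Z, offDiagM_self]
    have h1 : ∀ z, bigLink L 0 z Y = 1 := fun z => by simp [bigLink, topLink, chainL]
    simp [QM, hoff, h1, hQsum]
  | succ n ih =>
    obtain ⟨K, hK_def⟩ : ∃ K : PathSp L n → A n → ℝ, ∀ X u, K X u =
        if Y.split = (u, X) then -∑ᶠ Z : PathSp L (n + 1), offDiagM Q L Y.1 Z.1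
        else offStep Q L n X.1 u Y.split.2.1 Y.split.1 := ⟨_, fun _ _ => rfl⟩
    have hK : ∀ X : PathSp L (n + 1), QM Q L (n + 1) X Y = K X.split.2 X.split.1 := by
      intro X
      have hiff : Y.split = (X.split.1, X.split.2) ↔ X = Y :=
        PathSp.split_injective.eq_iff.trans eq_comm
      simp only [hK_def, if_congr hiff rfl rfl, QM]
      split_ifs with h
      · rw [h]
      · exact offDiagM_split Q X Y
    have hY := Y.topLink_split_ne_zero
    have hsum := finsum_offDiagM_split hQpos hL hQfin hLfin hcomm Y
    have hbig : ∀ z, bigLink L (n + 1) z Y = L n z Y.split.1 * bigLink L n Y.split.1 Y.split.2 :=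
      fun z => bigLink_split z Y
    generalize hp : Y.split = p at *
    obtain ⟨y, Y'⟩ := p
    dsimp only at hY hsum hbig hK_def
    have hrate : ∀ u, ∑ᶠ z : A n, Q n u z * bigLink L n z Y'
        = rateLink Q L n u Y'.1 * chainL L Y'.1 := by
      intro u
      rw [rateLink, finsum_mul]
      exact finsum_congr fun z => (mul_assoc _ _ _).symm
    have hstep : ∀ u, ∑ᶠ X : PathSp L n, bigLink L n u X * K X u
        = Q n u y * bigLink L n y Y' := by
      intro u
      by_cases hu : u = y
      · subst hu
        have hQM : ∀ X : PathSp L n, bigLink L n u X * K X u = bigLink L n u X * QM Q L n X Y'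
            - if X = Y' then (rateLink Q L n u Y'.1 / topLink L n u Y'.1 - Q n u u)
                * bigLink L n u Y' else 0 := by
          intro X
          by_cases hX : X = Y'
          · subst hX
            simp only [hK_def, QM, if_true, hsum]
            ring
          · have hX1 : X.1 ≠ Y'.1 := fun e => hX (Subtype.ext e)
            have hX2 : ¬ (u, Y') = (u, X) := fun e => hX (congrArg Prod.snd e).symm
            simp only [hK_def, QM, if_neg hX, if_neg hX2, offStep, if_neg hX1, topJump, if_pos hY,
              if_true, mul_one, sub_zero]
        rw [finsum_congr hQM, finsum_sub_distrib, ih, hrate,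
          finsum_eq_single _ Y' fun X hX => if_neg hX, if_pos rfl, bigLink]
        · field_simp
          ring
        · exact (bigLink_finite hLfin n u).subset fun X hX => left_ne_zero_of_mul hX
        · exact (Set.finite_singleton Y').subset fun v hv => (ite_ne_right_iff.1 hv).1
      · have hKu : ∀ X, K X u = offStep Q L n X.1 u Y'.1 y := fun X =>
          (hK_def X u).trans (if_neg fun e => hu (congrArg Prod.fst e).symm)
        simp only [hKu]
        by_cases hT : topLink L n u Y'.1 = 0
        · have hQM : ∀ X : PathSp L n, bigLink L n u X * offStep Q L n X.1 u Y'.1 y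
              = bigLink L n u X * QM Q L n X Y' * topJump Q L n u y Y'.1 := by
            intro X
            by_cases hX : X = Y'
            · rw [hX, bigLink, hT]
              ring
            · have hX1 : X.1 ≠ Y'.1 := fun e => hX (Subtype.ext e)
              rw [offStep, if_neg hX1, QM, if_neg hX, mul_assoc]
          rw [finsum_congr hQM, ← finsum_mul, ih, hrate, bigLink, ← mul_assoc,
            ← topJump_mul_rateLink hQpos hL hQfin hT]
          ring
        · rw [finsum_eq_single _ Y']
          · rw [offStep, if_pos rfl, if_neg (Ne.symm hu), bigLink, bigLink]
            field_simp
          · intro X hX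
            have hX1 : X.1 ≠ Y'.1 := fun e => hX (Subtype.ext e)
            rw [offStep, if_neg hX1, topJump, if_pos hT, if_neg (Ne.symm hu), mul_zero, mul_zero]
    calc ∑ᶠ X : PathSp L (n + 1), bigLink L (n + 1) x X * QM Q L (n + 1) X Y
        = ∑ᶠ p : A n × PathSp L n, L n x p.1 * (bigLink L n p.1 p.2 * K p.2 p.1) := by
          rw [← finsum_comp_split]
          · refine finsum_congr fun X => ?_
            rw [bigLink_split, hK, mul_assoc]
          · intro p hp
            rw [bigLink, hp]
            ring
      _ = ∑ᶠ (u : A n) (X : PathSp L n), L n x u * (bigLink L n u X * K X u) := by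
          refine finsum_curry _ ?_
          refine ((hLfin n x).biUnion fun u _ =>
            (Set.finite_singleton u).prod (bigLink_finite hLfin n u)).subset fun p hp => ?_
          simp only [Set.mem_iUnion]
          exact ⟨p.1, left_ne_zero_of_mul hp, rfl,
            left_ne_zero_of_mul (right_ne_zero_of_mul hp)⟩
      _ = (∑ᶠ u : A n, L n x u * Q n u y) * bigLink L n y Y' := by
          rw [finsum_mul]
          refine finsum_congr fun u => ?_
          rw [← mul_finsum, hstep, mul_assoc]
      _ = ∑ᶠ z : A (n + 1), Q (n + 1) x z * bigLink L (n + 1) z Y := by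
          rw [hcomm, finsum_mul]
          refine finsum_congr fun z => ?_
          rw [hbig, mul_assoc]

/-- Proposition 6.5 of Borodin–Olshanski: the multivariate transition rate matrix
commutes with the link to the top level, `Λ Q^{(N−1)} = Q_N Λ`.  (Here levels are
0-indexed: `n = N − 1 ≥ 1` is the index of the top level `A_N`.) -/
theorem stmt17 (A : ℕ → Type) [∀ k, Countable (A k)]
    (Q : ∀ k, A k → A k → ℝ) (L : ∀ k, A (k + 1) → A k → ℝ)
    (hQpos : ∀ k (x y : A k), x ≠ y → 0 ≤ Q k x y)
    (hQfin : ∀ k (x : A k), {y : A k | Q k x y ≠ 0}.Finite)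
    (hQsum : ∀ k (x : A k), ∑ᶠ y : A k, Q k x y = 0)
    (hL01 : ∀ k (x : A (k + 1)) (y : A k), 0 ≤ L k x y ∧ L k x y ≤ 1)
    (hLfin : ∀ k (x : A (k + 1)), {y : A k | L k x y ≠ 0}.Finite)
    (hLsum : ∀ k (x : A (k + 1)), ∑ᶠ y : A k, L k x y = 1)
    (hcomm : ∀ k (x : A (k + 1)) (y : A k),
      ∑ᶠ u : A k, L k x u * Q k u y = ∑ᶠ v : A (k + 1), Q (k + 1) x v * L k v y)
    (n : ℕ) (hn : 1 ≤ n) (x : A n) (Y : PathSp L n) :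
    ∑ᶠ X : PathSp L n, bigLink L n x X * QM Q L n X Y
      = ∑ᶠ z : A n, Q n x z * bigLink L n z Y := by
  exact finsum_bigLink_mul_QM hQpos (fun k x y => (hL01 k x y).1) hQfin hQsum hLfin hcomm n x Y

end Multivariate
end

section
/- In the bivariate setting below, for every (x*,x) ∈ A^{(2)} and every y ∈ A: Σ_{y* : (y*,y) ∈ A^{(2)}} Q^{(2)}((x*,x),(y*,y)) = Q(x,y), where the sum has finitely many nonzero terms, and for y = x the diagonal entry Q^{(2)}((x*,x),(x*,x)) is included in the sum. -/
open scoped Classical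

section Bivariate

variable {S A : Type}

/-- `Δ(x*, y) = Σ_{y* ≠ x*} Q*(x*, y*) Λ(y*, y)` (defined when `Λ(x*, y) = 0`). -/
noncomputable def DeltaB (Qs : S → S → ℝ) (L : S → A → ℝ) (xs : S) (y : A) : ℝ :=
  ∑ᶠ ys : S, if ys ≠ xs then Qs xs ys * L ys y else 0

/-- Off-diagonal entries of the bivariate transition rate matrix `Q^{(2)}` (as a function
on all of `S × A`; only its restriction to `A^{(2)}` is used). -/
noncomputable def offDiagB (Q : A → A → ℝ) (Qs : S → S → ℝ) (L : S → A → ℝ)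
    (p q : S × A) : ℝ :=
  if p = q then 0
  else if p.1 = q.1 then Q p.2 q.2
  else if p.2 = q.2 then Qs p.1 q.1 * L q.1 p.2 / L p.1 p.2
  else if L p.1 q.2 = 0 ∧ DeltaB Qs L p.1 q.2 ≠ 0 then
    Q p.2 q.2 * Qs p.1 q.1 * L q.1 q.2 / DeltaB Qs L p.1 q.2
  else 0

/-- The bivariate state space `A^{(2)} = {(x*, x) : Λ(x*, x) ≠ 0}`. -/
def A2 (L : S → A → ℝ) : Type := {p : S × A // L p.1 p.2 ≠ 0}

/-- The bivariate transition rate matrix `Q^{(2)}` on `A^{(2)}`; the diagonal entry is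
minus the sum of the off-diagonal entries of the row. -/
noncomputable def Q2 (Q : A → A → ℝ) (Qs : S → S → ℝ) (L : S → A → ℝ)
    (p q : A2 L) : ℝ :=
  if p = q then -∑ᶠ r : A2 L, offDiagB Q Qs L p.1 r.1
  else offDiagB Q Qs L p.1 q.1

/-- The off-diagonal entries of `Q^{(2)}` in the row of `p`, extended by zero to `S × A`. -/
noncomputable def extOffDiagB (Q : A → A → ℝ) (Qs : S → S → ℝ) (L : S → A → ℝ)
    (p q : S × A) : ℝ :=
  if L q.1 q.2 ≠ 0 then offDiagB Q Qs L p q else 0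

theorem support_extOffDiagB_finite (Q : A → A → ℝ) (Qs : S → S → ℝ) (L : S → A → ℝ)
    (hQsfin : ∀ xs : S, {ys : S | Qs xs ys ≠ 0}.Finite)
    (hLfin : ∀ xs : S, {x : A | L xs x ≠ 0}.Finite) (p : S × A) :
    (Function.support (extOffDiagB Q Qs L p)).Finite := by
  refine (((hQsfin p.1).insert p.1).biUnion
    (fun ys _ => (hLfin ys).image (fun z => (ys, z)))).subset ?_
  rintro ⟨ys, z⟩ hq
  simp only [Function.mem_support, extOffDiagB, offDiagB] at hq
  have hL : L ys z ≠ 0 := fun h => hq (by simp [h])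
  have hys : ys ∈ insert p.1 {ys : S | Qs p.1 ys ≠ 0} := by
    by_contra hn
    simp only [Set.mem_insert_iff, Set.mem_ofPred_eq, not_or, not_not] at hn
    exact hq (by simp [hn.2, Ne.symm hn.1])
  exact Set.mem_biUnion hys ⟨z, hL, rfl⟩

theorem finsum_A2_offDiagB (Q : A → A → ℝ) (Qs : S → S → ℝ) (L : S → A → ℝ) (p : S × A) :
    ∑ᶠ r : A2 L, offDiagB Q Qs L p r.1 = ∑ᶠ q : S × A, extOffDiagB Q Qs L p q := by
  have h := finsum_set_coe_eq_finsum_mem (f := offDiagB Q Qs L p) {q : S × A | L q.1 q.2 ≠ 0}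
  refine h.trans (finsum_congr fun q => ?_)
  rw [finsum_eq_if]
  rfl

theorem Q2_self (Q : A → A → ℝ) (Qs : S → S → ℝ) (L : S → A → ℝ) (p : A2 L) :
    Q2 Q Qs L p p = -∑ᶠ q : S × A, extOffDiagB Q Qs L p.1 q :=
  (if_pos rfl).trans (congrArg Neg.neg (finsum_A2_offDiagB Q Qs L p.1))

theorem Q2_of_ne (Q : A → A → ℝ) (Qs : S → S → ℝ) (L : S → A → ℝ) {p q : A2 L} (h : p ≠ q) :
    Q2 Q Qs L p q = extOffDiagB Q Qs L p.1 q.1 :=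
  (if_neg h).trans (if_pos q.2).symm

theorem finsum_extOffDiagB_of_ne (Q : A → A → ℝ) (Qs : S → S → ℝ) (L : S → A → ℝ)
    (hQpos : ∀ x y : A, x ≠ y → 0 ≤ Q x y)
    (hL0 : ∀ (xs : S) (x : A), 0 ≤ L xs x)
    (hLfin : ∀ xs : S, {x : A | L xs x ≠ 0}.Finite)
    (hcomm : ∀ (xs : S) (y : A),
      ∑ᶠ x : A, L xs x * Q x y = ∑ᶠ ys : S, Qs xs ys * L ys y)
    {xs : S} {x y : A} (hx : L xs x ≠ 0) (hxy : x ≠ y) :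
    ∑ᶠ ys : S, extOffDiagB Q Qs L (xs, x) (ys, y) = Q x y := by
  by_cases hy : L xs y = 0
  · have hterm : ∀ ys : S, extOffDiagB Q Qs L (xs, x) (ys, y) =
        Q x y / DeltaB Qs L xs y * (if ys ≠ xs then Qs xs ys * L ys y else 0) := by
      intro ys
      by_cases hs : ys = xs
      · subst hs
        simp [extOffDiagB, hy]
      · by_cases hl : L ys y = 0
        · simp [extOffDiagB, hl]
        · by_cases hd : DeltaB Qs L xs y = 0
          · simp [extOffDiagB, offDiagB, hl, hd, hxy, Ne.symm hs]
          · simp only [extOffDiagB, offDiagB, Prod.mk.injEq, hxy, Ne.symm hs, hl, hy, hd, hs,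
              ne_eq, not_false_eq_true, and_self, if_true, if_false]
            ring
    rw [finsum_congr hterm, ← mul_finsum]
    change Q x y / DeltaB Qs L xs y * DeltaB Qs L xs y = Q x y
    by_cases hd : DeltaB Qs L xs y = 0
    · have hsum : ∑ᶠ z : A, L xs z * Q z y = 0 := by
        rw [hcomm, ← hd]
        refine finsum_congr fun ys => ?_
        by_cases hs : ys = xs
        · subst hs
          simp [hy]
        · simp [hs]
      have hnonneg : ∀ z : A, 0 ≤ L xs z * Q z y := by
        intro z
        by_cases hz : z = y
        · subst hz
          simp [hy]
        · exact mul_nonneg (hL0 xs z) (hQpos z y hz)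
      have hfin : (Function.support fun z : A => L xs z * Q z y).Finite :=
        (hLfin xs).subset fun z hz => left_ne_zero_of_mul hz
      have hle := single_le_finsum x hfin hnonneg
      rw [hsum] at hle
      have h0 := (mul_eq_zero.1 (le_antisymm hle (hnonneg x))).resolve_left hx
      simp [h0]
    · exact div_mul_cancel₀ _ hd
  · rw [finsum_eq_single _ xs]
    · simp [extOffDiagB, offDiagB, hy, hxy]
    · intro ys hs
      simp [extOffDiagB, offDiagB, hy, hxy, Ne.symm hs]

/-- Collapsibility relation (6.5) of Borodin–Olshanski: for every `(x*, x) ∈ A^{(2)}` and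
`y ∈ A`, `Σ_{y* : (y*,y) ∈ A^{(2)}} Q^{(2)}((x*,x),(y*,y)) = Q(x,y)` (for `y = x` the
diagonal entry is included in the sum). -/
theorem stmt18 [Countable S] [Countable A]
    (Q : A → A → ℝ) (Qs : S → S → ℝ) (L : S → A → ℝ)
    (hQpos : ∀ x y : A, x ≠ y → 0 ≤ Q x y)
    (hQfin : ∀ x : A, {y : A | Q x y ≠ 0}.Finite)
    (hQsum : ∀ x : A, ∑ᶠ y : A, Q x y = 0)
    (hQspos : ∀ xs ys : S, xs ≠ ys → 0 ≤ Qs xs ys)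
    (hQsfin : ∀ xs : S, {ys : S | Qs xs ys ≠ 0}.Finite)
    (hQssum : ∀ xs : S, ∑ᶠ ys : S, Qs xs ys = 0)
    (hL01 : ∀ (xs : S) (x : A), 0 ≤ L xs x ∧ L xs x ≤ 1)
    (hLfin : ∀ xs : S, {x : A | L xs x ≠ 0}.Finite)
    (hLsum : ∀ xs : S, ∑ᶠ x : A, L xs x = 1)
    (hcomm : ∀ (xs : S) (y : A),
      ∑ᶠ x : A, L xs x * Q x y = ∑ᶠ ys : S, Qs xs ys * L ys y)
    (p : A2 L) (y : A) :
    (∑ᶠ ys : S, if h : L ys y ≠ 0 then Q2 Q Qs L p ⟨(ys, y), h⟩ else 0) = Q p.1.2 y := by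
  obtain ⟨⟨xs, x⟩, hx⟩ := p
  change L xs x ≠ 0 at hx
  have hoff : ∀ z : A, x ≠ z → ∑ᶠ ys : S, extOffDiagB Q Qs L (xs, x) (ys, z) = Q x z :=
    fun z hz => finsum_extOffDiagB_of_ne Q Qs L hQpos (fun xs x => (hL01 xs x).1) hLfin hcomm hx hz
  by_cases hxy : x = y
  · subst hxy
    have hfin := support_extOffDiagB_finite Q Qs L hQsfin hLfin (xs, x)
    have hcolfin : (Function.support fun ys : S => extOffDiagB Q Qs L (xs, x) (ys, x)).Finite :=
      (hfin.image Prod.fst).subset fun ys hys => ⟨(ys, x), hys, rfl⟩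
    have hdiag : Q2 Q Qs L ⟨(xs, x), hx⟩ ⟨(xs, x), hx⟩ =
        Q x x - ∑ᶠ ys : S, extOffDiagB Q Qs L (xs, x) (ys, x) := by
      set T := ∑ᶠ ys : S, extOffDiagB Q Qs L (xs, x) (ys, x) with hT
      have hswap : ∑ᶠ q : S × A, extOffDiagB Q Qs L (xs, x) q =
          ∑ᶠ z : A, ∑ᶠ ys : S, extOffDiagB Q Qs L (xs, x) (ys, z) := by
        rw [← finsum_comp_equiv (Equiv.prodComm A S), finsum_curry]
        · rfl
        · exact hfin.preimage (Equiv.prodComm A S).injective.injOn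
      have hcol : ∀ z : A, ∑ᶠ ys : S, extOffDiagB Q Qs L (xs, x) (ys, z) =
          Q x z + if z = x then T - Q x x else 0 := by
        intro z
        by_cases hz : z = x
        · subst hz
          simp [hT]
        · simp [hoff z (Ne.symm hz), hz]
      have hcorr : (Function.support fun z : A => if z = x then T - Q x x else 0).Finite :=
        (Set.finite_singleton x).subset fun z hz => by
          by_contra hn
          exact hz (if_neg hn)
      refine (Q2_self Q Qs L ⟨(xs, x), hx⟩).trans ?_
      rw [hswap, finsum_congr hcol,
        finsum_add_distrib (hQfin x) hcorr, hQsum, finsum_eq_single _ x fun z hz => if_neg hz,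
        if_pos rfl]
      ring
    have hterm : ∀ ys : S,
        (if h : L ys x ≠ 0 then Q2 Q Qs L ⟨(xs, x), hx⟩ ⟨(ys, x), h⟩ else 0) =
          extOffDiagB Q Qs L (xs, x) (ys, x) +
            if ys = xs then Q2 Q Qs L ⟨(xs, x), hx⟩ ⟨(xs, x), hx⟩ else 0 := by
      intro ys
      by_cases hs : ys = xs
      · subst hs
        rw [dif_pos hx, if_pos rfl]
        simp [extOffDiagB, offDiagB]
      · rw [if_neg hs, add_zero]
        by_cases hl : L ys x = 0
        · simp [extOffDiagB, hl]
        · rw [dif_pos hl]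
          exact Q2_of_ne Q Qs L fun h => hs (congrArg (fun q => q.1.1) h).symm
    rw [finsum_congr hterm, finsum_add_distrib hcolfin, finsum_eq_single _ xs fun z hz => if_neg hz,
      if_pos rfl, hdiag]
    · ring
    · exact (Set.finite_singleton xs).subset fun z hz => by
        by_contra hn
        exact hz (if_neg hn)
  · rw [← hoff y hxy]
    refine finsum_congr fun ys => ?_
    by_cases hl : L ys y = 0
    · simp [extOffDiagB, hl]
    · rw [dif_pos hl]
      exact Q2_of_ne Q Qs L fun h => hxy (congrArg (fun q => q.1.2) h)

end Bivariate
end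

section
/- Let N ≥ 1, s ∈ ℝ, t ≥ 0, and set d_N = Σ_{j=0}^{N−1}(j(j−1) + s·j) = N(N−1)(N−2)/3 + s·N(N−1)/2. Suppose p : ℤ × ℤ → [0,∞) satisfies: (i) for every x ∈ ℤ, Σ_{y∈ℤ} p(x,y)(1+|y|)^{N−1} < ∞; (ii) for every m = 0,1,…,N−1 there is a polynomial q_m of degree strictly less than m such that Σ_{y∈ℤ} p(x,y)·y^m = e^{(m(m−1)+s·m)t}·x^m + q_m(x) for all x ∈ ℤ (in particular, for m = 0, Σ_y p(x,y) = 1). Then for every X = (x_1 > x_2 > … > x_N) ∈ 𝕏_N: Σ_{Y∈𝕏_N} e^{−d_N t} · (V(Y)/V(X)) · det[p(x_i, y_j)]_{i,j=1}^N = 1, the sum converging absolutely. -/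
/-- Strictly decreasing integer `N`-tuples `𝕏_N`. -/
def XN (N : ℕ) : Type := {x : Fin N → ℤ // ∀ i j : Fin N, i < j → x j < x i}

/-- The Vandermonde product `∏_{i<j} (x_i − x_j)` as a real number. -/
def VR {N : ℕ} (x : Fin N → ℤ) : ℝ :=
  ∏ i : Fin N, ∏ j : Fin N, if i < j then ((x i : ℝ) - (x j : ℝ)) else 1

/-- A finite product of absolutely convergent series is summed over tuples of indices. -/
theorem hasSum_pi_prod_of_summable_norm {ι : Type*} {n : ℕ} (f : Fin n → ι → ℝ)
    (hf : ∀ i, Summable fun y => ‖f i y‖) :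
    HasSum (fun Z : Fin n → ι => ∏ i, f i (Z i)) (∏ i, ∑' y, f i y) ∧
      Summable fun Z : Fin n → ι => ‖∏ i, f i (Z i)‖ := by
  induction n with
  | zero =>
    simp only [Finset.univ_eq_empty, Finset.prod_empty]
    exact ⟨hasSum_unique _, (hasSum_unique _).summable⟩
  | succ n ih =>
    obtain ⟨hs, hn⟩ := ih (fun i => f i.succ) fun i => hf i.succ
    have hn' := (hf 0).mul_norm hn
    have hmul := (hf 0).of_norm.hasSum.mul hs hn'.of_norm
    rw [← (Fin.consEquiv fun _ => ι).hasSum_iff, ← (Fin.consEquiv fun _ => ι).summable_iff]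
    simp only [Function.comp_def, Fin.consEquiv, Equiv.coe_fn_mk, Fin.prod_univ_succ,
      Fin.cons_zero, Fin.cons_succ]
    exact ⟨hmul, hn'⟩

/-- The determinant with entries `∑ f i j` is a sum of determinants, one for each choice of the
summation index in every row. -/
theorem hasSum_det_of_summable_norm {ι : Type*} {n : ℕ} (f : Fin n → Fin n → ι → ℝ)
    (hf : ∀ i j, Summable fun y => ‖f i j y‖) :
    HasSum (fun Z : Fin n → ι => (Matrix.of fun i j => f i j (Z i)).det)
      (Matrix.of fun i j => ∑' y, f i j y).det := by
  simp only [← Matrix.det_transpose (Matrix.of _), Matrix.det_apply', Matrix.transpose_apply,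
    Matrix.of_apply]
  exact hasSum_sum fun σ _ =>
    (hasSum_pi_prod_of_summable_norm (fun i => f i (σ i)) fun i => hf i (σ i)).1.mul_left _

theorem XN.strictAnti {N : ℕ} (X : XN N) : StrictAnti X.1 := fun i j h => X.2 i j h

theorem XN.comp_perm_injective (N : ℕ) :
    Function.Injective fun a : XN N × Equiv.Perm (Fin N) => a.1.1 ∘ a.2 := by
  rintro ⟨Y, σ⟩ ⟨Y', σ'⟩ h
  have h' : Y.1 ∘ σ = Y'.1 ∘ σ' := h
  have hY : Y = Y' := by
    apply Subtype.ext
    rw [← Y.strictAnti.range_inj Y'.strictAnti, ← σ.surjective.range_comp Y.1, h',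
      σ'.surjective.range_comp]
  subst hY
  have hσ : σ = σ' := Equiv.ext fun i => Y.strictAnti.injective (congrFun h' i)
  rw [hσ]

theorem XN.exists_comp_perm_eq {N : ℕ} {Z : Fin N → ℤ} (hZ : Function.Injective Z) :
    ∃ a : XN N × Equiv.Perm (Fin N), a.1.1 ∘ a.2 = Z := by
  let τ := Tuple.sort fun i => - Z i
  have hmono : Monotone fun i => - Z (τ i) := Tuple.monotone_sort fun i => - Z i
  have hanti : ∀ i j : Fin N, i < j → Z (τ j) < Z (τ i) := fun i j hij =>
    lt_of_le_of_ne (neg_le_neg_iff.1 (hmono hij.le))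
      fun h => hij.ne' (τ.injective (hZ h))
  refine ⟨(⟨Z ∘ τ, hanti⟩, τ⁻¹), ?_⟩
  ext i
  simp

theorem det_vandermonde_comp_perm {N : ℕ} (v : Fin N → ℝ) (σ : Equiv.Perm (Fin N)) :
    (Matrix.vandermonde (v ∘ σ)).det = (Equiv.Perm.sign σ : ℝ) * (Matrix.vandermonde v).det :=
  Matrix.det_permute σ (Matrix.vandermonde v)

/-- `VR` agrees with the Vandermonde determinant up to a sign depending only on `N`. -/
theorem VR_eq_det_vandermonde {N : ℕ} (x : Fin N → ℤ) :
    VR x = (∏ i : Fin N, ∏ _j ∈ Finset.Ioi i, (-1 : ℝ)) *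
      (Matrix.vandermonde fun i => (x i : ℝ)).det := by
  simp only [VR, Matrix.det_vandermonde, ← Finset.prod_mul_distrib]
  refine Finset.prod_congr rfl fun i _ => ?_
  rw [← Finset.prod_filter, Finset.filter_lt_eq_Ioi]
  exact Finset.prod_congr rfl fun j _ => by ring

theorem VR_div_VR {N : ℕ} (x y : Fin N → ℤ) :
    VR y / VR x = (Matrix.vandermonde fun i => (y i : ℝ)).det /
      (Matrix.vandermonde fun i => (x i : ℝ)).det := by
  rw [VR_eq_det_vandermonde, VR_eq_det_vandermonde, mul_div_mul_left]
  simp [Finset.prod_ne_zero_iff]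

/-- Antisymmetrization: a sum over all integer tuples weighted by the Vandermonde determinant
folds into a sum of determinants over strictly decreasing tuples. -/
theorem hasSum_XN_vandermonde_mul_det {N : ℕ} (f : Fin N → ℤ → ℝ) {a : ℝ}
    (h : HasSum (fun Z : Fin N → ℤ =>
      (Matrix.vandermonde fun i => (Z i : ℝ)).det * ∏ i, f i (Z i)) a) :
    HasSum (fun Y : XN N => (Matrix.vandermonde fun i => (Y.1 i : ℝ)).det *
      (Matrix.of fun i j => f i (Y.1 j)).det) a := by
  rw [← (XN.comp_perm_injective N).hasSum_iff] at h
  · refine h.prod_fiberwise fun Y => ?_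
    rw [← Matrix.det_transpose (Matrix.of fun i j => f i (Y.1 j)),
      Matrix.det_apply' (Matrix.transpose _), Finset.mul_sum]
    refine (hasSum_fintype _).congr_fun fun σ => ?_
    have hσ := det_vandermonde_comp_perm (fun i => (Y.1 i : ℝ)) σ
    simp only [Function.comp_def] at hσ
    simp only [Function.comp_def, hσ, Matrix.transpose_apply, Matrix.of_apply]
    ring
  · intro Z hZ
    have hinj : ¬ Function.Injective fun i => (Z i : ℝ) := fun hi =>
      hZ (XN.exists_comp_perm_eq fun i j hij => hi (by simp [hij]))
    rw [not_not.1 (mt Matrix.det_vandermonde_ne_zero_iff.1 hinj), zero_mul]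

/-- A triangular perturbation of the monomials scales the Vandermonde determinant by the product
of the leading coefficients. -/
theorem det_leading_mul_pow_add_eval {N : ℕ} (v c : Fin N → ℝ) (hc : ∀ j, c j ≠ 0)
    (q : Fin N → Polynomial ℝ) (hq : ∀ j, (q j).degree < (j : ℕ)) :
    (Matrix.of fun i j => c j * v i ^ (j : ℕ) + (q j).eval (v i)).det =
      (∏ j, c j) * (Matrix.vandermonde v).det := by
  have hdeg (j : Fin N) : (Polynomial.C (c j)⁻¹ * q j).degree < (j : ℕ) := by
    rw [Polynomial.degree_C_mul (inv_ne_zero (hc j))]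
    exact hq j
  rw [Matrix.det_eval_matrixOfPolynomials_eq_det_vandermonde v
    (fun j => Polynomial.X ^ (j : ℕ) + Polynomial.C (c j)⁻¹ * q j)
    (fun j => Polynomial.natDegree_eq_of_degree_eq_some (by
      rw [Polynomial.degree_add_eq_left_of_degree_lt, Polynomial.degree_X_pow]
      rw [Polynomial.degree_X_pow]
      exact hdeg j))
    (fun j => Polynomial.monic_X_pow_add (hdeg j)), ← Matrix.det_mul_row]
  congr 1
  ext i j
  simp [mul_add, hc j]

theorem summable_norm_mul_pow {N : ℕ} {f : ℤ → ℝ} (hf : ∀ y, 0 ≤ f y)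
    (hmom : Summable fun y : ℤ => f y * (1 + |(y : ℝ)|) ^ (N - 1)) {m : ℕ} (hm : m < N) :
    Summable fun y : ℤ => ‖f y * (y : ℝ) ^ m‖ := by
  refine hmom.of_nonneg_of_le (fun _ => norm_nonneg _) fun y => ?_
  rw [norm_mul, norm_pow, Real.norm_of_nonneg (hf y), Real.norm_eq_abs]
  refine mul_le_mul_of_nonneg_left ?_ (hf y)
  calc |(y : ℝ)| ^ m ≤ (1 + |(y : ℝ)|) ^ m := by gcongr; linarith
    _ ≤ (1 + |(y : ℝ)|) ^ (N - 1) :=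
      pow_le_pow_right₀ (by linarith [abs_nonneg (y : ℝ)]) (by omega)

theorem sum_fin_eigenvalue_exponent (N : ℕ) (s : ℝ) :
    ∑ j : Fin N, (((j : ℕ) : ℝ) * (((j : ℕ) : ℝ) - 1) + s * ((j : ℕ) : ℝ)) =
      (N : ℝ) * ((N : ℝ) - 1) * ((N : ℝ) - 2) / 3 + s * ((N : ℝ) * ((N : ℝ) - 1)) / 2 := by
  induction N with
  | zero => simp
  | succ n ih =>
    rw [Fin.sum_univ_castSucc]
    simp only [Fin.val_castSucc, Fin.val_last, ih]
    push_cast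
    ring

/-- Step 2 of the proof of Theorem 3.7 in Borodin–Olshanski: if `p : ℤ × ℤ → [0,∞)` has
row sums against `(1+|y|)^{N−1}` finite and acts on monomials `y^m` (`m < N`) with
eigenvalue `e^{(m(m−1)+s·m)t}` on the leading term modulo lower degree, then the
Doob-transform determinantal expression
`e^{−d_N t} (V(Y)/V(X)) det[p(x_i,y_j)]` sums to `1` over `Y ∈ 𝕏_N`, absolutely. -/
theorem stmt19 (N : ℕ) (hN : 1 ≤ N) (s : ℝ) (t : ℝ) (ht : 0 ≤ t)
    (p : ℤ → ℤ → ℝ) (hp : ∀ x y, 0 ≤ p x y)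
    (hmom : ∀ x : ℤ, Summable (fun y : ℤ => p x y * (1 + |(y : ℝ)|) ^ (N - 1)))
    (heig : ∀ m : ℕ, m < N →
      ∃ q : Polynomial ℝ, q.degree < (m : ℕ) ∧ ∀ x : ℤ,
        (∑' y : ℤ, p x y * (y : ℝ) ^ m)
          = Real.exp (((m : ℝ) * ((m : ℝ) - 1) + s * (m : ℝ)) * t) * (x : ℝ) ^ m +
              q.eval (x : ℝ))
    (X : XN N) :
    HasSum
      (fun Y : XN N =>
        Real.exp (-(((N : ℝ) * ((N : ℝ) - 1) * ((N : ℝ) - 2) / 3 +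
            s * ((N : ℝ) * ((N : ℝ) - 1)) / 2)) * t) *
          (VR Y.1 / VR X.1) *
          Matrix.det (Matrix.of fun i j : Fin N => p (X.1 i) (Y.1 j)))
      1 := by
  choose q hqdeg hq using heig
  set d : ℝ := (N : ℝ) * ((N : ℝ) - 1) * ((N : ℝ) - 2) / 3 +
    s * ((N : ℝ) * ((N : ℝ) - 1)) / 2 with hd
  have hV : (Matrix.vandermonde fun i => (X.1 i : ℝ)).det ≠ 0 :=
    Matrix.det_vandermonde_ne_zero_iff.2 (Int.cast_injective.comp X.strictAnti.injective)
  have hdet := hasSum_det_of_summable_norm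
    (fun (i j : Fin N) (y : ℤ) => p (X.1 i) y * (y : ℝ) ^ (j : ℕ))
    fun i j => summable_norm_mul_pow (hp _) (hmom _) j.2
  simp only [hq _ (Fin.is_lt _)] at hdet
  rw [det_leading_mul_pow_add_eval (fun i => (X.1 i : ℝ))
    (fun j : Fin N => Real.exp ((((j : ℕ) : ℝ) * (((j : ℕ) : ℝ) - 1) + s * ((j : ℕ) : ℝ)) * t))
    (fun _ => Real.exp_ne_zero _) (fun j => q j j.2) (fun j => hqdeg j j.2), ← Real.exp_sum,
    ← Finset.sum_mul, sum_fin_eigenvalue_exponent, ← hd] at hdet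
  have hfold := hasSum_XN_vandermonde_mul_det (fun i => p (X.1 i)) <| hdet.congr_fun fun Z => by
    rw [mul_comm, ← Matrix.det_mul_column]
    rfl
  have hone : Real.exp (-d * t) / (Matrix.vandermonde fun i => (X.1 i : ℝ)).det *
      (Real.exp (d * t) * (Matrix.vandermonde fun i => (X.1 i : ℝ)).det) = 1 := by
    rw [div_mul_eq_mul_div, ← mul_assoc, ← Real.exp_add, neg_mul, neg_add_cancel, Real.exp_zero,
      one_mul, div_self hV]
  rw [← hone]
  refine (hfold.mul_left _).congr_fun fun Y => ?_
  rw [VR_div_VR]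
  ring
end
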